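/- arXiv:1702.04745 — 2 statements merged into one kernel-verified Lean document; each statement's English description precedes it below -/
import Mathlib

section
/- For n ≥ 1, let H_n be the random variable 'total height' (sum over all vertices of the distance to the root) on the set of complete binary trees with 2n+1 vertices, equipped with the uniform distribution. Let μ(n) = E[H_n], m_i(n) = E[(H_n − μ(n))^i], and α_i(n) = m_i(n)/m_2(n)^{i/2}. Then lim_{n→∞} α_7(n) = (162π³ + (6615/4)π² − (103965/32)π − 101897475/9152)·√3·√(π/(10 − 3π)) / (10 − 3π)³ ≈ 90.0171829093603301…. -/
inductive PTree : Type
  | node : List PTree → PTree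

namespace PTree

/-- Number of vertices of an ordered rooted (plane) tree. -/
def size : PTree → ℕ
  | node ts => 1 + (ts.attach.map fun t => size t.1).sum
decreasing_by
  have := List.sizeOf_lt_of_mem t.2
  simp only [PTree.node.sizeOf_spec]
  omega

/-- Total height: sum over all vertices of the distance to the root. -/
def totalHeight : PTree → ℕ
  | node ts => (ts.attach.map fun t => totalHeight t.1 + size t.1).sum
decreasing_by
  have := List.sizeOf_lt_of_mem t.2
  simp only [PTree.node.sizeOf_spec]
  omega

/-- Every vertex has no children, or a number of children belonging to `S`. -/
def validDeg (S : Finset ℕ) : PTree → Prop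
  | node ts => (ts = [] ∨ ts.length ∈ S) ∧ ∀ t ∈ ts, validDeg S t
decreasing_by
  have := List.sizeOf_lt_of_mem (by assumption : t ∈ ts)
  simp only [PTree.node.sizeOf_spec]
  omega

end PTree


open Filter Real

namespace TH
open PowerSeries

/-- The Euler operator `X d/dX`. -/
noncomputable def theta (f : PowerSeries ℝ) : PowerSeries ℝ := PowerSeries.X * PowerSeries.derivative ℝ f

lemma coeff_theta (f : PowerSeries ℝ) (n : ℕ) :
    PowerSeries.coeff n (theta f) = n * PowerSeries.coeff n f := by
  unfold theta
  cases n with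
  | zero => simp
  | succ n =>
    rw [PowerSeries.coeff_succ_X_mul, PowerSeries.coeff_derivative]
    push_cast; ring

lemma theta_mul (f g : PowerSeries ℝ) : theta (f * g) = theta f * g + f * theta g := by
  unfold theta
  rw [Derivation.leibniz]; simp only [smul_eq_mul]; ring

lemma theta_aeval (s : PowerSeries ℝ) (Q : Polynomial ℝ) :
    theta (Polynomial.aeval s Q) = Polynomial.aeval s (Polynomial.derivative Q) * theta s := by
  unfold theta
  rw [Derivation.map_aeval]; simp only [smul_eq_mul]; ring

lemma theta_pow (s : PowerSeries ℝ) (d : ℕ) :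
    theta (s ^ d) * s = d * s ^ d * theta s := by
  unfold theta
  rw [Derivation.leibniz_pow]
  cases d with
  | zero => simp
  | succ d => simp only [smul_eq_mul, nsmul_eq_mul]; simp [pow_succ]; ring

/-- `f * s^d` is a polynomial in `s` with constant term `c`. -/
def Asy (s f : PowerSeries ℝ) (d : ℕ) (c : ℝ) : Prop :=
  ∃ Q : Polynomial ℝ, f * s ^ d = Polynomial.aeval s Q ∧ Q.eval 0 = c

variable {s f g : PowerSeries ℝ} {d e : ℕ} {c c' : ℝ}

lemma Asy.add (h : Asy s f d c) (h' : Asy s g d c') : Asy s (f + g) d (c + c') := by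
  obtain ⟨Q, h1, h2⟩ := h
  obtain ⟨R, h3, h4⟩ := h'
  exact ⟨Q + R, by simp [add_mul, h1, h3], by simp [h2, h4]⟩

lemma Asy.mul (h : Asy s f d c) (h' : Asy s g e c') : Asy s (f * g) (d + e) (c * c') := by
  obtain ⟨Q, h1, h2⟩ := h
  obtain ⟨R, h3, h4⟩ := h'
  refine ⟨Q * R, ?_, by simp [h2, h4]⟩
  rw [map_mul, ← h1, ← h3]; ring

lemma Asy.const_mul (h : Asy s f d c) (a : ℝ) : Asy s (PowerSeries.C a * f) d (a * c) := by
  obtain ⟨Q, h1, h2⟩ := h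
  refine ⟨Polynomial.C a * Q, ?_, by simp [h2]⟩
  rw [map_mul, ← h1, Polynomial.aeval_C]
  rw [mul_assoc]; rfl

lemma Asy.raise_lt (h : Asy s f d c) (hde : d < e) : Asy s f e 0 := by
  obtain ⟨Q, h1, h2⟩ := h
  refine ⟨Polynomial.X ^ (e - d) * Q, ?_, by simp [show e - d ≠ 0 by omega]⟩
  rw [map_mul, ← h1, map_pow, Polynomial.aeval_X]
  conv_lhs => rw [show e = (e - d) + d by omega, pow_add]
  ring

lemma Asy.raise (h : Asy s f d 0) (hde : d ≤ e) : Asy s f e 0 := by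
  rcases hde.eq_or_lt with rfl | h'
  · exact h
  · exact h.raise_lt h'

lemma Asy.zero : Asy s 0 d 0 := ⟨0, by simp, by simp⟩

lemma Asy.sum {ι : Type*} (S : Finset ι) (F : ι → PowerSeries ℝ) (C : ι → ℝ)
    (h : ∀ i ∈ S, Asy s (F i) d (C i)) : Asy s (∑ i ∈ S, F i) d (∑ i ∈ S, C i) := by
  classical
  induction S using Finset.induction_on with
  | empty => simpa using Asy.zero
  | insert a S ha ih =>
    rw [Finset.sum_insert ha, Finset.sum_insert ha]
    exact (h a (by simp)).add (ih fun i hi => h i (by simp [hi]))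

/-- `2 (theta - 1)` -/
noncomputable def DD (f : PowerSeries ℝ) : PowerSeries ℝ := PowerSeries.C 2 * (theta f - f)

lemma coeff_DD (f : PowerSeries ℝ) (n : ℕ) :
    PowerSeries.coeff n (DD f) = 2 * ((n : ℝ) - 1) * PowerSeries.coeff n f := by
  unfold DD
  rw [PowerSeries.coeff_C_mul, map_sub, coeff_theta]; ring

lemma s_theta (hs : s ^ 2 = 1 - 4 * PowerSeries.X) : s * theta s = - 2 * PowerSeries.X := by
  have h : theta (s ^ 2) = theta (1 - 4 * PowerSeries.X) := by rw [hs]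
  have h2 : theta (1 - 4 * PowerSeries.X : PowerSeries ℝ) = - 4 * PowerSeries.X := by
    ext n
    rw [coeff_theta]
    have e4 : (4 : PowerSeries ℝ) = PowerSeries.C 4 := (map_ofNat PowerSeries.C 4).symm
    rw [e4, neg_mul, map_neg, map_sub, PowerSeries.coeff_C_mul, PowerSeries.coeff_X, PowerSeries.coeff_one]
    split_ifs <;> simp_all
  rw [h2, sq, theta_mul] at h
  have h3 : PowerSeries.C 2 * (s * theta s) = PowerSeries.C 2 * (- 2 * PowerSeries.X) := by
    have e2 : PowerSeries.C 2 = (2 : PowerSeries ℝ) := map_ofNat PowerSeries.C 2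
    rw [e2]; linear_combination h
  exact mul_left_cancel₀ (by simp) h3

lemma Asy.theta (hs : s ^ 2 = 1 - 4 * PowerSeries.X) (h : Asy s f d c) :
    Asy s (theta f) (d + 2) (d / 2 * c) := by
  obtain ⟨Q, h1, h2⟩ := h
  have hst := s_theta hs
  refine ⟨Polynomial.C (1/2) * (Polynomial.X ^ 2 - 1) *
    (Polynomial.X * Polynomial.derivative Q - Polynomial.C (d:ℝ) * Q), ?_, ?_⟩
  · have h3 : TH.theta (f * s ^ d) = _ := congrArg TH.theta h1
    rw [theta_mul, theta_aeval] at h3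
    have h4 := theta_pow s d
    have hC : Polynomial.aeval s (Polynomial.C (1/2 : ℝ)) = PowerSeries.C (1/2 : ℝ) := by
      rw [Polynomial.aeval_C]; rfl
    have hd : Polynomial.aeval s (Polynomial.C (d : ℝ)) = (d : PowerSeries ℝ) := by
      simp
    simp only [map_mul, map_sub, map_pow, Polynomial.aeval_X, map_one, hC, hd]
    rw [hs, ← h1]
    have e2 : PowerSeries.C (1/2:ℝ) * 2 = 1 := by
      have e2 : PowerSeries.C (2:ℝ) = (2 : PowerSeries ℝ) := map_ofNat PowerSeries.C 2
      rw [← e2, ← map_mul]; norm_num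
    have key : TH.theta f * s ^ (d + 2) =
        (Polynomial.aeval s (Polynomial.derivative Q) * s - d * (f * s ^ d)) * (s * TH.theta s) := by
      linear_combination s ^ 2 * h3 - f * s * h4
    rw [key, hst]
    linear_combination (-(Polynomial.aeval s (Polynomial.derivative Q) * s - d * (f * s ^ d)) * 2 * PowerSeries.X) * (-e2)
  · simp [h2]; ring

lemma Asy.DD (hs : s ^ 2 = 1 - 4 * PowerSeries.X) (h : Asy s f d c) :
    Asy s (DD f) (d + 2) (d * c) := by
  have h1 := (h.theta hs).const_mul 2
  have h2 := (h.raise_lt (show d < d + 2 by omega)).const_mul (-2)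
  have h3 := h1.add h2
  unfold TH.DD
  have e : PowerSeries.C 2 * (TH.theta f - f) = PowerSeries.C 2 * TH.theta f + PowerSeries.C (-2) * f := by
    rw [map_neg]; ring
  rw [e]
  convert h3 using 1; ring

/-! Coefficient asymptotics -/

variable {I : PowerSeries ℝ}

lemma coeff_I_rec (hs : s ^ 2 = 1 - 4 * PowerSeries.X) (hI : I * s = 1) (j n : ℕ) :
    ((n : ℝ) + 1) * PowerSeries.coeff (n + 1) (I ^ j) = (4 * n + 2 * j) * PowerSeries.coeff n (I ^ j) := by
  have h1 : theta (I ^ j) * (1 - 4 * PowerSeries.X) = (2 * j : PowerSeries ℝ) * (PowerSeries.X * I ^ j) := by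
    have h2 := theta_pow I j
    have h3 : theta (I * s) = 0 := by
      rw [hI]; ext n; rw [coeff_theta, PowerSeries.coeff_one]; split_ifs <;> simp_all
    rw [theta_mul] at h3
    have h4 := s_theta hs
    have h5 : theta I * s ^ 2 = 2 * PowerSeries.X * I := by
      linear_combination s * h3 - I * h4
    have h6 : theta (I ^ j) * (I * s) * s = j * I ^ j * theta I * s ^ 2 := by
      linear_combination s ^ 2 * h2
    rw [hI, mul_assoc _ (theta I), h5, mul_one] at h6
    rw [← hs]
    linear_combination s * h6 + 2 * j * I ^ j * PowerSeries.X * hI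
  have h2 := congrArg (PowerSeries.coeff (n + 1)) h1
  have e4 : (4 : PowerSeries ℝ) = PowerSeries.C 4 := (map_ofNat PowerSeries.C 4).symm
  have ej : (2 * j : PowerSeries ℝ) = PowerSeries.C (2 * j : ℝ) := by
    rw [map_mul, map_natCast]; congr 1
  rw [ej, PowerSeries.coeff_C_mul, PowerSeries.coeff_succ_X_mul, mul_sub, mul_one, map_sub, coeff_theta,
    show theta (I ^ j) * (4 * PowerSeries.X) = PowerSeries.C 4 * (PowerSeries.X * theta (I ^ j)) by rw [e4]; ring,
    PowerSeries.coeff_C_mul, PowerSeries.coeff_succ_X_mul, coeff_theta] at h2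
  push_cast at h2
  linarith

lemma coeff_I (hs : s ^ 2 = 1 - 4 * PowerSeries.X) (hI : I * s = 1)
    (hI0 : PowerSeries.coeff 0 I = 1) (j n : ℕ) :
    PowerSeries.coeff n (I ^ j) = 4 ^ n * (∏ i ∈ Finset.range n, ((j : ℝ) / 2 + i)) / n.factorial := by
  induction n with
  | zero =>
    simp only [PowerSeries.coeff_zero_eq_constantCoeff] at hI0
    simp [hI0]
  | succ n ih =>
    have h := coeff_I_rec hs hI j n
    rw [ih] at h
    have hn : ((n : ℝ) + 1) ≠ 0 := by positivity
    apply mul_left_cancel₀ hn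
    rw [h, Finset.prod_range_succ, Nat.factorial_succ]
    push_cast
    field_simp
    ring

lemma coeff_I_tendsto (hs : s ^ 2 = 1 - 4 * PowerSeries.X) (hI : I * s = 1)
    (hI0 : PowerSeries.coeff 0 I = 1) (j : ℕ) (hj : 1 ≤ j) :
    Tendsto (fun n : ℕ => PowerSeries.coeff n (I ^ j) / (4 ^ n * (n : ℝ) ^ ((j : ℝ) / 2 - 1))) atTop
      (nhds (1 / Real.Gamma ((j : ℝ) / 2))) := by
  have hpos : (0 : ℝ) < (j : ℝ) / 2 := by positivity
  have h1 := Real.GammaSeq_tendsto_Gamma ((j : ℝ) / 2)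
  have h2 : Tendsto (fun n : ℕ => (n : ℝ) / (n + (j : ℝ) / 2)) atTop (nhds 1) :=
    tendsto_natCast_div_add_atTop _
  have h3 := h2.div h1 (Real.Gamma_pos_of_pos hpos).ne'
  refine h3.congr' ?_
  filter_upwards [eventually_gt_atTop 0] with n hn
  have hn' : (0 : ℝ) < n := by exact_mod_cast hn
  rw [Pi.div_apply, coeff_I hs hI hI0, Real.GammaSeq, Finset.prod_range_succ, Real.rpow_sub_one hn'.ne']
  have h4 : (0:ℝ) < ∏ i ∈ Finset.range n, ((j : ℝ) / 2 + i) := Finset.prod_pos fun i _ => by positivity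
  have h5 : (0:ℝ) < (n : ℝ) ^ ((j : ℝ) / 2) := by positivity
  have h6 : (0:ℝ) < n.factorial := by positivity
  generalize (∏ i ∈ Finset.range n, ((j : ℝ) / 2 + i)) = A at *
  generalize (n : ℝ) ^ ((j : ℝ) / 2) = B at *
  have h7 : (n:ℝ) + j/2 ≠ 0 := by positivity
  have h8 : (j:ℝ)/2 + n ≠ 0 := by positivity
  field_simp
  ring

lemma rpow_small (a : ℝ) (ha : a < 0) : Tendsto (fun n : ℕ => (n : ℝ) ^ a) atTop (nhds 0) := by
  have := (tendsto_rpow_neg_atTop (show 0 < -a by linarith)).comp (tendsto_natCast_atTop_atTop (R := ℝ))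
  simpa [Function.comp_def] using this

lemma coeff_I_small (hs : s ^ 2 = 1 - 4 * PowerSeries.X) (hI : I * s = 1)
    (hI0 : PowerSeries.coeff 0 I = 1) (j d : ℕ) (hj : 1 ≤ j) (hd : j < d) :
    Tendsto (fun n : ℕ => PowerSeries.coeff n (I ^ j) / (4 ^ n * (n : ℝ) ^ ((d : ℝ) / 2 - 1))) atTop
      (nhds 0) := by
  have hjd : (j : ℝ) < d := by exact_mod_cast hd
  have h := (coeff_I_tendsto hs hI hI0 j hj).mul (rpow_small ((j : ℝ) / 2 - d / 2) (by linarith))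
  rw [mul_zero] at h
  refine h.congr' ?_
  filter_upwards [eventually_gt_atTop 0] with n hn
  have hn' : (0 : ℝ) < n := by exact_mod_cast hn
  rw [show (j : ℝ) / 2 - d / 2 = ((j : ℝ) / 2 - 1) - (d / 2 - 1) by ring,
    Real.rpow_sub hn' ((j : ℝ) / 2 - 1) (d / 2 - 1)]
  have h5 : (0:ℝ) < (n : ℝ) ^ ((j : ℝ) / 2 - 1) := by positivity
  have h6 : (0:ℝ) < (n : ℝ) ^ ((d : ℝ) / 2 - 1) := by positivity
  generalize (n : ℝ) ^ ((j : ℝ) / 2 - 1) = A at *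
  generalize (n : ℝ) ^ ((d : ℝ) / 2 - 1) = B at *
  field_simp

lemma small_step (hf : Tendsto (fun n : ℕ => PowerSeries.coeff n f / 4 ^ n) atTop (nhds 0)) :
    Tendsto (fun n : ℕ => PowerSeries.coeff n (f * (1 - 4 * PowerSeries.X)) / 4 ^ n) atTop (nhds 0) := by
  rw [← tendsto_add_atTop_iff_nat 1] 
  have h1 := (tendsto_add_atTop_iff_nat 1).2 hf
  have h2 := h1.sub hf
  rw [sub_zero] at h2
  refine h2.congr fun n => ?_
  have e4 : (4 : PowerSeries ℝ) = PowerSeries.C 4 := (map_ofNat PowerSeries.C 4).symm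
  rw [show f * (1 - 4 * PowerSeries.X) = f - PowerSeries.C 4 * (PowerSeries.X * f) by rw [e4]; ring,
    map_sub, PowerSeries.coeff_C_mul, PowerSeries.coeff_succ_X_mul, pow_succ]
  field_simp

lemma coeff_I_four (hs : s ^ 2 = 1 - 4 * PowerSeries.X) (hI : I * s = 1)
    (hI0 : PowerSeries.coeff 0 I = 1) :
    Tendsto (fun n : ℕ => PowerSeries.coeff n I / 4 ^ n) atTop (nhds 0) := by
  have h := coeff_I_small hs hI hI0 1 2 le_rfl (by norm_num)
  simpa using h

lemma coeff_s_small (hs : s ^ 2 = 1 - 4 * PowerSeries.X) (hI : I * s = 1)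
    (hI0 : PowerSeries.coeff 0 I = 1) (m : ℕ) :
    Tendsto (fun n : ℕ => PowerSeries.coeff n (s ^ m) / 4 ^ n) atTop (nhds 0) ∧
    Tendsto (fun n : ℕ => PowerSeries.coeff n (s ^ (m + 1)) / 4 ^ n) atTop (nhds 0) := by
  induction m with
  | zero =>
    constructor
    · refine tendsto_const_nhds.congr' ?_
      filter_upwards [eventually_gt_atTop 0] with n hn
      simp [PowerSeries.coeff_one, hn.ne']
    · have h := small_step (coeff_I_four hs hI hI0)
      rw [← hs, show I * s ^ 2 = s by rw [sq, ← mul_assoc, hI, one_mul]] at h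
      simpa using h
  | succ m ih =>
    refine ⟨ih.2, ?_⟩
    have h := small_step ih.1
    rw [← hs] at h
    rw [show m + 1 + 1 = m + 2 by ring, pow_add]
    exact h

lemma coeff_term (hs : s ^ 2 = 1 - 4 * PowerSeries.X) (hI : I * s = 1)
    (hI0 : PowerSeries.coeff 0 I = 1) (d : ℕ) (hd : 2 ≤ d) (i : ℕ) (hi : 1 ≤ i) :
    Tendsto (fun n : ℕ => PowerSeries.coeff n (I ^ d * s ^ i) / (4 ^ n * (n : ℝ) ^ ((d : ℝ) / 2 - 1)))
      atTop (nhds 0) := by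
  by_cases h : i < d
  · have e : I ^ d * s ^ i = I ^ (d - i) := by
      conv_lhs => rw [show d = (d - i) + i by omega, pow_add, mul_assoc, ← mul_pow, hI, one_pow, mul_one]
    rw [e]
    exact coeff_I_small hs hI hI0 _ _ (by omega) (by omega)
  · have e : I ^ d * s ^ i = s ^ (i - d) := by
      conv_lhs => rw [show i = d + (i - d) by omega, pow_add, ← mul_assoc, ← mul_pow, hI, one_pow, one_mul]
    rw [e]
    have h1 := (coeff_s_small hs hI hI0 (i - d)).1
    refine squeeze_zero_norm' ?_ (tendsto_norm_zero.comp h1)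
    filter_upwards [eventually_gt_atTop 0] with n hn
    have hn' : (1 : ℝ) ≤ n := by exact_mod_cast hn
    have hd' : (2 : ℝ) ≤ d := by exact_mod_cast hd
    have h2 : 1 ≤ (n : ℝ) ^ ((d : ℝ) / 2 - 1) := Real.one_le_rpow hn' (by linarith)
    rw [← div_div, norm_div, Function.comp]
    apply div_le_self (norm_nonneg _)
    rw [Real.norm_eq_abs]
    exact h2.trans (le_abs_self _)

lemma Asy.tendsto (hs : s ^ 2 = 1 - 4 * PowerSeries.X) (hI : I * s = 1)
    (hI0 : PowerSeries.coeff 0 I = 1) (hd : 2 ≤ d) (h : Asy s f d c) :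
    Tendsto (fun n : ℕ => PowerSeries.coeff n f / (4 ^ n * (n : ℝ) ^ ((d : ℝ) / 2 - 1))) atTop
      (nhds (c / Real.Gamma ((d : ℝ) / 2))) := by
  obtain ⟨Q, h1, h2⟩ := h
  have hf : f = ∑ i ∈ Finset.range (Q.natDegree + 1), PowerSeries.C (Q.coeff i) * (I ^ d * s ^ i) := by
    have : f = I ^ d * (f * s ^ d) := by
      rw [mul_left_comm, ← mul_pow, hI, one_pow, mul_one]
    rw [this, h1, Polynomial.aeval_eq_sum_range, Finset.mul_sum]
    refine Finset.sum_congr rfl fun i _ => ?_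
    rw [PowerSeries.smul_eq_C_mul]; ring
  have h3 : ∀ n : ℕ, PowerSeries.coeff n f / (4 ^ n * (n : ℝ) ^ ((d : ℝ) / 2 - 1)) =
      ∑ i ∈ Finset.range (Q.natDegree + 1),
        Q.coeff i * (PowerSeries.coeff n (I ^ d * s ^ i) / (4 ^ n * (n : ℝ) ^ ((d : ℝ) / 2 - 1))) := by
    intro n
    rw [hf, map_sum, Finset.sum_div]
    refine Finset.sum_congr rfl fun i _ => ?_
    rw [PowerSeries.coeff_C_mul, mul_div_assoc]
  simp_rw [h3, Finset.sum_range_succ']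
  rw [show c / Real.Gamma ((d : ℝ) / 2) = (∑ i ∈ Finset.range Q.natDegree, Q.coeff (i + 1) * 0) +
    Q.coeff 0 * (1 / Real.Gamma ((d : ℝ) / 2)) by
      rw [Polynomial.coeff_zero_eq_eval_zero, h2]; simp [div_eq_mul_inv]]
  refine Tendsto.add (tendsto_finsetSum _ fun i _ => ?_) ?_
  · exact (coeff_term hs hI hI0 d hd (i + 1) (by omega)).const_mul _
  · refine Tendsto.const_mul _ ?_
    simpa using coeff_I_tendsto hs hI hI0 d (by omega)

end TH

namespace TH

lemma size_nil : (PTree.node []).size = 1 := by simp [PTree.size]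
lemma size_two (l r : PTree) : (PTree.node [l, r]).size = 1 + (l.size + r.size) := by
  simp [PTree.size]
lemma height_nil : (PTree.node []).totalHeight = 0 := by simp [PTree.totalHeight]
lemma height_two (l r : PTree) : (PTree.node [l, r]).totalHeight =
    (l.totalHeight + l.size) + (r.totalHeight + r.size) := by
  simp [PTree.totalHeight]
lemma valid_nil : (PTree.node []).validDeg {2} := by simp [PTree.validDeg]
lemma valid_two (l r : PTree) : (PTree.node [l, r]).validDeg {2} ↔ l.validDeg {2} ∧ r.validDeg {2} := by
  simp [PTree.validDeg]

lemma valid_cases (t : PTree) (h : t.validDeg {2}) :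
    t = PTree.node [] ∨ ∃ l r, t = PTree.node [l, r] := by
  obtain ⟨ts⟩ := t
  rw [PTree.validDeg] at h
  rcases h.1 with h | h
  · left; rw [h]
  · right
    rw [Finset.mem_singleton, List.length_eq_two] at h
    obtain ⟨l, r, h⟩ := h
    exact ⟨l, r, by rw [h]⟩

lemma valid_odd (N : ℕ) : ∀ t : PTree, t.size ≤ N → t.validDeg {2} → ∃ n, t.size = 2 * n + 1 := by
  induction N with
  | zero =>
    intro t ht hv
    rcases valid_cases t hv with rfl | ⟨l, r, rfl⟩
    · exact ⟨0, size_nil⟩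
    · rw [size_two] at ht; omega
  | succ N ih =>
    intro t ht hv
    rcases valid_cases t hv with rfl | ⟨l, r, rfl⟩
    · exact ⟨0, size_nil⟩
    · rw [size_two] at ht
      rw [valid_two] at hv
      obtain ⟨a, ha⟩ := ih l (by omega) hv.1
      obtain ⟨b, hb⟩ := ih r (by omega) hv.2
      exact ⟨a + b + 1, by rw [size_two]; omega⟩

section
variable {T : ℕ → Finset PTree}
  (hT : ∀ n : ℕ, ∀ t : PTree, t ∈ T n ↔ t.size = 2 * n + 1 ∧ t.validDeg {2})

lemma T_zero (hT : ∀ n : ℕ, ∀ t : PTree, t ∈ T n ↔ t.size = 2 * n + 1 ∧ t.validDeg {2}) :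
    T 0 = {PTree.node []} := by
  ext t
  rw [hT, Finset.mem_singleton]
  constructor
  · rintro ⟨h1, h2⟩
    rcases valid_cases t h2 with rfl | ⟨l, r, rfl⟩
    · rfl
    · rw [size_two] at h1
      rw [valid_two] at h2
      obtain ⟨a, ha⟩ := valid_odd _ l le_rfl h2.1
      omega
  · rintro rfl
    exact ⟨size_nil, valid_nil⟩

lemma T_sum_succ (hT : ∀ n : ℕ, ∀ t : PTree, t ∈ T n ↔ t.size = 2 * n + 1 ∧ t.validDeg {2})
    (n : ℕ) (f : PTree → ℝ) :
    ∑ t ∈ T (n + 1), f t = ∑ p ∈ Finset.HasAntidiagonal.antidiagonal n, ∑ l ∈ T p.1, ∑ r ∈ T p.2, f (PTree.node [l, r]) := by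
  simp_rw [← Finset.sum_product']
  rw [Finset.sum_sigma']
  symm
  refine Finset.sum_bij (fun x _ => PTree.node [x.2.1, x.2.2]) ?_ ?_ ?_ ?_
  · rintro ⟨⟨i, j⟩, l, r⟩ h
    simp only [Finset.mem_sigma, Finset.HasAntidiagonal.mem_antidiagonal, Finset.mem_product, hT] at h
    rw [hT, size_two, valid_two]
    exact ⟨by dsimp only; omega, h.2.1.2, h.2.2.2⟩
  · rintro ⟨⟨i, j⟩, l, r⟩ h ⟨⟨i', j'⟩, l', r'⟩ h' he
    simp only [Finset.mem_sigma, Finset.HasAntidiagonal.mem_antidiagonal, Finset.mem_product, hT] at h h'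
    simp only [PTree.node.injEq, List.cons.injEq, and_true] at he
    obtain ⟨rfl, rfl⟩ := he
    obtain rfl : i = i' := by omega
    obtain rfl : j = j' := by omega
    rfl
  · intro t ht
    rw [hT] at ht
    rcases valid_cases t ht.2 with rfl | ⟨l, r, rfl⟩
    · rw [size_nil] at ht; omega
    · rw [valid_two, size_two] at ht
      obtain ⟨a, ha⟩ := valid_odd _ l le_rfl ht.2.1
      obtain ⟨b, hb⟩ := valid_odd _ r le_rfl ht.2.2
      refine ⟨⟨(a, b), l, r⟩, ?_, rfl⟩
      simp only [Finset.mem_sigma, Finset.HasAntidiagonal.mem_antidiagonal, Finset.mem_product, hT]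
      exact ⟨by omega, ⟨ha, ht.2.1⟩, hb, ht.2.2⟩
  · intro x _
    rfl

/-- Power sums of the total height. -/
noncomputable def SS (T : ℕ → Finset PTree) (k n : ℕ) : ℝ := ∑ t ∈ T n, (t.totalHeight : ℝ) ^ k

lemma trinom (x y z : ℝ) (k : ℕ) : (x + y + z) ^ k = ∑ c ∈ Finset.range (k + 1),
    (k.choose c : ℝ) * (z ^ c * ∑ a ∈ Finset.range (k - c + 1), ((k - c).choose a : ℝ) * (x ^ a * y ^ (k - c - a))) := by
  rw [add_comm, add_pow]
  refine Finset.sum_congr rfl fun c _ => ?_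
  rw [add_pow, Finset.mul_sum, Finset.sum_mul, Finset.mul_sum, Finset.mul_sum]
  exact Finset.sum_congr rfl fun a _ => by ring

lemma SS_succ (hT : ∀ n : ℕ, ∀ t : PTree, t ∈ T n ↔ t.size = 2 * n + 1 ∧ t.validDeg {2}) (k n : ℕ) :
    SS T k (n + 1) = ∑ c ∈ Finset.range (k + 1), (k.choose c : ℝ) * ((2 * ((n : ℝ) + 1)) ^ c *
      ∑ a ∈ Finset.range (k - c + 1), ((k - c).choose a : ℝ) *
        ∑ p ∈ Finset.HasAntidiagonal.antidiagonal n, SS T a p.1 * SS T (k - c - a) p.2) := by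
  unfold SS
  rw [T_sum_succ hT]
  have h : ∀ p ∈ Finset.HasAntidiagonal.antidiagonal n, (∑ l ∈ T p.1, ∑ r ∈ T p.2, ((PTree.node [l, r]).totalHeight : ℝ) ^ k)
      = ∑ c ∈ Finset.range (k + 1), (k.choose c : ℝ) * ((2 * ((n : ℝ) + 1)) ^ c *
      ∑ a ∈ Finset.range (k - c + 1), ((k - c).choose a : ℝ) *
        ((∑ t ∈ T p.1, (t.totalHeight : ℝ) ^ a) * ∑ t ∈ T p.2, (t.totalHeight : ℝ) ^ (k - c - a))) := by
    intro p hp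
    rw [Finset.HasAntidiagonal.mem_antidiagonal] at hp
    have h1 : ∀ l ∈ T p.1, ∀ r ∈ T p.2, ((PTree.node [l, r]).totalHeight : ℝ) ^ k =
        ∑ c ∈ Finset.range (k + 1), (k.choose c : ℝ) * ((2 * ((n : ℝ) + 1)) ^ c *
        ∑ a ∈ Finset.range (k - c + 1), ((k - c).choose a : ℝ) *
        ((l.totalHeight : ℝ) ^ a * (r.totalHeight : ℝ) ^ (k - c - a))) := by
      intro l hl r hr
      rw [hT] at hl hr
      rw [← trinom, height_two, hl.1, hr.1, ← hp]
      push_cast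
      congr 1; ring
    rw [Finset.sum_congr rfl fun l hl => Finset.sum_congr rfl fun r hr => h1 l hl r hr]
    simp_rw [Finset.sum_comm (s := T p.2), Finset.sum_comm (s := T p.1), ← Finset.mul_sum,
      Finset.sum_comm (s := T p.2), Finset.sum_comm (s := T p.1), ← Finset.mul_sum, ← Finset.sum_mul, ← Finset.mul_sum]
  rw [Finset.sum_congr rfl h]
  simp_rw [Finset.sum_comm (s := Finset.HasAntidiagonal.antidiagonal n), ← Finset.mul_sum,
    Finset.sum_comm (s := Finset.HasAntidiagonal.antidiagonal n), ← Finset.mul_sum]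

lemma SS_zero (hT : ∀ n : ℕ, ∀ t : PTree, t ∈ T n ↔ t.size = 2 * n + 1 ∧ t.validDeg {2}) (k : ℕ) :
    SS T k 0 = 0 ^ k := by
  unfold SS
  rw [T_zero hT]; simp [height_nil]

/-- Shifted generating functions. -/
noncomputable def GG (T : ℕ → Finset PTree) (k : ℕ) : PowerSeries ℝ := PowerSeries.X * PowerSeries.mk (SS T k)

/-- Binomial convolution. -/
noncomputable def EE (G : ℕ → PowerSeries ℝ) (m : ℕ) : PowerSeries ℝ :=
  ∑ a ∈ Finset.range (m + 1), PowerSeries.C (m.choose a : ℝ) * (G a * G (m - a))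

lemma coeff_DD_iter (f : PowerSeries ℝ) (c n : ℕ) :
    PowerSeries.coeff n (DD^[c] f) = (2 * ((n : ℝ) - 1)) ^ c * PowerSeries.coeff n f := by
  induction c with
  | zero => simp
  | succ c ih => rw [Function.iterate_succ_apply', coeff_DD, ih]; ring

lemma GG_mul (a b : ℕ) : GG T a * GG T b =
    PowerSeries.X * (PowerSeries.X * (PowerSeries.mk (SS T a) * PowerSeries.mk (SS T b))) := by
  unfold GG; ring

lemma GG_rec (hT : ∀ n : ℕ, ∀ t : PTree, t ∈ T n ↔ t.size = 2 * n + 1 ∧ t.validDeg {2}) (k : ℕ) :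
    GG T k = (if k = 0 then PowerSeries.X else 0) +
      ∑ c ∈ Finset.range (k + 1), PowerSeries.C (k.choose c : ℝ) * DD^[c] (EE (GG T) (k - c)) := by
  have hz : ∀ N, N ≤ 1 → ∀ m, PowerSeries.coeff N (EE (GG T) m) = 0 := by
    intro N hN m
    unfold EE
    rw [map_sum]
    refine Finset.sum_eq_zero fun a _ => ?_
    rw [PowerSeries.coeff_C_mul, GG_mul]
    interval_cases N
    · simp
    · rw [PowerSeries.coeff_succ_X_mul]; simp
  ext N
  rw [map_add, map_sum]
  simp_rw [PowerSeries.coeff_C_mul, coeff_DD_iter]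
  rcases N with _ | _ | n
  · simp_rw [hz 0 (by norm_num)]
    split_ifs <;> simp [GG]
  · simp_rw [hz _ (by norm_num : 0 + 1 ≤ 1)]
    unfold GG
    rw [PowerSeries.coeff_succ_X_mul, PowerSeries.coeff_mk, SS_zero hT]
    split_ifs with h <;> simp [h]
  · have e0 : PowerSeries.coeff (n + 1 + 1) (if k = 0 then (PowerSeries.X : PowerSeries ℝ) else 0) = 0 := by
      split_ifs <;> simp [PowerSeries.coeff_X]
    rw [e0, zero_add]
    conv_lhs => unfold GG
    rw [PowerSeries.coeff_succ_X_mul, PowerSeries.coeff_mk, SS_succ hT]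
    refine Finset.sum_congr rfl fun c _ => ?_
    unfold EE
    rw [map_sum]
    congr 2
    · push_cast; ring
    · refine Finset.sum_congr rfl fun a _ => ?_
      rw [PowerSeries.coeff_C_mul, GG_mul, PowerSeries.coeff_succ_X_mul, PowerSeries.coeff_succ_X_mul,
        PowerSeries.coeff_mul]
      simp

end

end TH

namespace TH

/-- Leading coefficients of the singular expansions. -/
noncomputable def gg : ℕ → ℝ
  | 0 => 1 / 2
  | 1 => 1 / 2
  | 2 => 5 / 2
  | 3 => 45
  | 4 => 3315 / 2
  | 5 => 101700
  | 6 => 18635625 / 2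
  | 7 => 1189944000
  | _ => 0

lemma gg_rec (k : ℕ) (h2 : 2 ≤ k) (h7 : k ≤ 7) :
    gg k = (∑ a ∈ Finset.Ico 1 k, (k.choose a : ℝ) * (gg a * gg (k - a))) +
      k * ((3 * (k - 1) - 1 : ℕ) * gg (k - 1)) := by
  interval_cases k <;> norm_num [Finset.sum_Ico_eq_sum_range, Finset.sum_range_succ, gg, Nat.choose]

lemma Asy.DD_iter_zero {s f : PowerSeries ℝ} {d : ℕ} (hs : s ^ 2 = 1 - 4 * PowerSeries.X)
    (h : Asy s f d 0) (c : ℕ) : Asy s (TH.DD^[c] f) (d + 2 * c) 0 := by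
  induction c with
  | zero => simpa using h
  | succ c ih =>
    rw [Function.iterate_succ_apply']
    have := ih.DD hs
    rw [mul_zero] at this
    exact this

lemma EE_split (G : ℕ → PowerSeries ℝ) (m : ℕ) (hm : 1 ≤ m) :
    EE G m = PowerSeries.C 2 * (G 0 * G m) +
      ∑ a ∈ Finset.Ico 1 m, PowerSeries.C (m.choose a : ℝ) * (G a * G (m - a)) := by
  unfold EE
  rw [Finset.sum_range_succ, Finset.range_eq_Ico, Finset.sum_eq_sum_Ico_succ_bot (by omega)]
  have e2 : PowerSeries.C 2 = (2 : PowerSeries ℝ) := map_ofNat PowerSeries.C 2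
  simp only [Nat.choose_zero_right, Nat.choose_self, Nat.sub_zero, Nat.sub_self, Nat.cast_one, map_one, e2]
  ring

lemma Asy_main (G : ℕ → PowerSeries ℝ)
    (hG : ∀ k, G k = (if k = 0 then PowerSeries.X else 0) +
      ∑ c ∈ Finset.range (k + 1), PowerSeries.C (k.choose c : ℝ) * DD^[c] (EE G (k - c)))
    (s : PowerSeries ℝ) (hsG : s = 1 - PowerSeries.C 2 * G 0)
    (hs : s ^ 2 = 1 - 4 * PowerSeries.X) (k : ℕ) (hk : k ≤ 7) :
    Asy s (G k) (3 * k - 1) (gg k) := by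
  have e2 : PowerSeries.C 2 = (2 : PowerSeries ℝ) := map_ofNat PowerSeries.C 2
  have e12 : PowerSeries.C (1/2:ℝ) * 2 = 1 := by
    rw [← e2, ← map_mul]; norm_num
  have hA0 : Asy s (G 0) 0 (1 / 2) := by
    refine ⟨Polynomial.C (1/2) * (1 - Polynomial.X), ?_, by simp⟩
    have hC : Polynomial.aeval s (Polynomial.C (1/2 : ℝ)) = PowerSeries.C (1/2 : ℝ) := by
      rw [Polynomial.aeval_C]; rfl
    rw [map_mul, hC, map_sub, map_one, Polynomial.aeval_X, hsG, e2]
    linear_combination (-G 0) * e12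
  have hE0 : EE G 0 = G 0 * G 0 := by simp [EE]
  induction k using Nat.strong_induction_on with
  | _ k ih =>
  rcases Nat.eq_zero_or_pos k with rfl | hk0
  · simpa [gg] using hA0
  -- the recursion, solved for `G k`
  have hrec : s * G k = (∑ a ∈ Finset.Ico 1 k, PowerSeries.C (k.choose a : ℝ) * (G a * G (k - a))) +
      ∑ c ∈ Finset.Ico 1 (k + 1), PowerSeries.C (k.choose c : ℝ) * DD^[c] (EE G (k - c)) := by
    have h := hG k
    rw [if_neg (by omega), Finset.range_eq_Ico, Finset.sum_eq_sum_Ico_succ_bot (by omega),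
      Nat.choose_zero_right, Nat.sub_zero, EE_split G k hk0] at h
    simp only [Function.iterate_zero, id, Nat.cast_one, map_one, one_mul, zero_add] at h
    rw [hsG]
    linear_combination h
  rcases Nat.lt_or_ge 1 k with hk1 | hk1
  · -- main case
    have hlow : ∀ c ∈ Finset.Ico 2 (k + 1), Asy s (DD^[c] (EE G (k - c))) (3 * k - 2) 0 := by
      intro c hc
      rw [Finset.mem_Ico] at hc
      rcases Nat.eq_zero_or_pos (k - c) with h0 | h0
      · have hck : c = k := by omega
        rw [h0, hE0, hck]
        have h1 := (hA0.mul hA0).DD hs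
        simp only [add_zero, Nat.cast_zero, zero_mul, zero_add] at h1
        have h2 := h1.DD_iter_zero hs (k - 1)
        rw [← Function.iterate_succ_apply, show (k - 1).succ = k by omega] at h2
        exact h2.raise (by omega)
      · have h1 : Asy s (EE G (k - c)) (3 * (k - c)) 0 := by
          unfold EE
          have := Asy.sum (s := s) (d := 3 * (k - c)) (Finset.range (k - c + 1))
            (fun a => PowerSeries.C ((k - c).choose a : ℝ) * (G a * G (k - c - a))) (fun _ => 0) ?_
          · simpa using this
          · intro a ha
            rw [Finset.mem_range] at ha
            have h3 := ((ih a (by omega) (by omega)).mul (ih (k - c - a) (by omega) (by omega))).const_mul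
              ((k - c).choose a : ℝ)
            exact h3.raise_lt (by omega)
        exact (h1.DD_iter_zero hs c).raise (by omega)
    have hE1 : Asy s (EE G (k - 1)) (3 * (k - 1) - 1) (gg (k - 1)) := by
      rw [EE_split G _ (by omega)]
      have h1 := (hA0.mul (ih (k - 1) (by omega) (by omega))).const_mul 2
      have h2 := Asy.sum (s := s) (d := 3 * (k - 1) - 1) (Finset.Ico 1 (k - 1))
            (fun a => PowerSeries.C ((k - 1).choose a : ℝ) * (G a * G (k - 1 - a))) (fun _ => 0) ?_
      · rw [zero_add] at h1
        convert h1.add h2 using 1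
        simp
      · intro a ha
        rw [Finset.mem_Ico] at ha
        have h3 := ((ih a (by omega) (by omega)).mul (ih (k - 1 - a) (by omega) (by omega))).const_mul
              ((k - 1).choose a : ℝ)
        exact h3.raise_lt (by omega)
    have hD1 := (hE1.DD hs).const_mul (k : ℝ)
    rw [show 3 * (k - 1) - 1 + 2 = 3 * k - 2 by omega] at hD1
    have hmid := Asy.sum (s := s) (d := 3 * k - 2) (Finset.Ico 1 k)
      (fun a => PowerSeries.C (k.choose a : ℝ) * (G a * G (k - a)))
      (fun a => (k.choose a : ℝ) * (gg a * gg (k - a))) (by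
        intro a ha
        rw [Finset.mem_Ico] at ha
        have h3 := ((ih a (by omega) (by omega)).mul (ih (k - a) (by omega) (by omega))).const_mul
              (k.choose a : ℝ)
        rwa [show 3 * a - 1 + (3 * (k - a) - 1) = 3 * k - 2 by omega] at h3)
    have hlow' := Asy.sum (s := s) (d := 3 * k - 2) (Finset.Ico 2 (k + 1))
      (fun c => PowerSeries.C (k.choose c : ℝ) * DD^[c] (EE G (k - c)))
      (fun c => (k.choose c : ℝ) * 0) (fun c hc => (hlow c hc).const_mul _)
    rw [Finset.sum_eq_sum_Ico_succ_bot (show 1 < k + 1 by omega), Nat.choose_one_right] at hrec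
    have htot := hmid.add (hD1.add hlow')
    rw [show DD (EE G (k - 1)) = DD^[1] (EE G (k - 1)) from rfl] at htot
    simp only [show 1 + 1 = 2 from rfl] at hrec
    rw [← hrec] at htot
    obtain ⟨Q, h1, h2⟩ := htot
    refine ⟨Q, ?_, ?_⟩
    · rw [← h1, show 3 * k - 1 = (3 * k - 2) + 1 by omega, pow_succ]; ring
    · rw [h2, gg_rec k hk1 hk]; simp
  · -- `k = 1`
    obtain rfl : k = 1 := by omega
    simp only [Finset.Ico_self, Finset.sum_empty, zero_add, Nat.Ico_succ_singleton, Finset.sum_singleton,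
      Nat.choose_self, Nat.cast_one, map_one, one_mul, Function.iterate_one, Nat.sub_self, hE0] at hrec
    have hG0 : G 0 = PowerSeries.C (1/2) * (1 - s) := by
      rw [hsG, e2]; linear_combination (-G 0) * e12
    have hth : DD (G 0 * G 0) * s = PowerSeries.C (1/2) * (1 - s) * (1 - s ^ 2) -
        PowerSeries.C (1/2) * (1 - s) ^ 2 * s := by
      have h0 : theta (G 0) = - (PowerSeries.C (1/2) * theta s) := by
        ext n
        rw [hG0, map_neg, coeff_theta, PowerSeries.coeff_C_mul, PowerSeries.coeff_C_mul, coeff_theta, map_sub,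
          PowerSeries.coeff_one]
        split_ifs with h
        · simp [h]
        · ring
      have h1 := s_theta hs
      have h2 : s ^ 2 - 1 = - 4 * PowerSeries.X := by rw [hs]; ring
      unfold DD
      rw [theta_mul, h0, e2, hG0]
      have e14 : PowerSeries.C (1/2:ℝ) * PowerSeries.C (1/2:ℝ) * 2 = PowerSeries.C (1/2:ℝ) := by
        rw [mul_assoc, e12, mul_one]
      generalize PowerSeries.C (1/2:ℝ) = h at *
      linear_combination (- 4 * h * h * (1 - s)) * h1 - (1-s) * h * (s^2 - 1) * e12 + (1-s)*h*h*2 * h2 - s * (1-s)^2 * e14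
    refine ⟨Polynomial.C (1/2) * (1 - Polynomial.X) * (1 - Polynomial.X ^ 2) -
      Polynomial.C (1/2) * (1 - Polynomial.X) ^ 2 * Polynomial.X, ?_, ?_⟩
    · have hC : Polynomial.aeval s (Polynomial.C (1/2 : ℝ)) = PowerSeries.C (1/2 : ℝ) := by
        rw [Polynomial.aeval_C]; rfl
      simp only [map_mul, map_sub, map_one, map_pow, hC, Polynomial.aeval_X]
      rw [← hth, ← hrec]
      ring
    · simp [gg]

end TH

namespace TH

lemma s_sq {T : ℕ → Finset PTree}
    (hT : ∀ n : ℕ, ∀ t : PTree, t ∈ T n ↔ t.size = 2 * n + 1 ∧ t.validDeg {2}) :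
    (1 - PowerSeries.C 2 * GG T 0) ^ 2 = 1 - 4 * PowerSeries.X := by
  have h := GG_rec hT 0
  simp [EE] at h
  have e2 : PowerSeries.C 2 = (2 : PowerSeries ℝ) := map_ofNat PowerSeries.C 2
  rw [e2]
  linear_combination (-4) * h

lemma coeff_GG (T : ℕ → Finset PTree) (k n : ℕ) : PowerSeries.coeff (n + 1) (GG T k) = SS T k n := by
  unfold GG
  rw [PowerSeries.coeff_succ_X_mul, PowerSeries.coeff_mk]

lemma SS_card (T : ℕ → Finset PTree) (n : ℕ) : SS T 0 n = (T n).card := by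
  simp [SS]

lemma I_facts {s : PowerSeries ℝ} (hs : s ^ 2 = 1 - 4 * PowerSeries.X) :
    (s - 2 * theta s) * s = 1 := by
  have := s_theta hs
  linear_combination hs - 2 * this

lemma coeff_I_eq (s : PowerSeries ℝ) (n : ℕ) :
    PowerSeries.coeff n (s - 2 * theta s) = (1 - 2 * n) * PowerSeries.coeff n s := by
  have e2 : PowerSeries.C 2 = (2 : PowerSeries ℝ) := map_ofNat PowerSeries.C 2
  rw [← e2, map_sub, PowerSeries.coeff_C_mul, coeff_theta]; ring

lemma card_limit {T : ℕ → Finset PTree}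
    (hT : ∀ n : ℕ, ∀ t : PTree, t ∈ T n ↔ t.size = 2 * n + 1 ∧ t.validDeg {2}) :
    Tendsto (fun N : ℕ => PowerSeries.coeff N (GG T 0) / (4 ^ N * (N : ℝ) ^ (-(3 / 2) : ℝ))) atTop
      (nhds (1 / (4 * √π))) := by
  set s : PowerSeries ℝ := 1 - PowerSeries.C 2 * GG T 0 with hsdef
  have hs := s_sq hT
  rw [← hsdef] at hs
  have hI := I_facts hs
  have hI0 : PowerSeries.coeff 0 (s - 2 * theta s) = 1 := by
    rw [coeff_I_eq]; simp [hsdef, GG]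
  have h1 := coeff_I_tendsto hs hI hI0 1 le_rfl
  rw [Nat.cast_one, Real.Gamma_one_half_eq] at h1
  have h2 : Tendsto (fun n : ℕ => (n : ℝ) / (n + (-1/2))) atTop (nhds 1) :=
    tendsto_natCast_div_add_atTop _
  have h3 := (h1.mul h2).const_mul (1/4)
  rw [show 1 / (4 * √π) = 1 / 4 * (1 / √π * 1) by field_simp]
  refine h3.congr' ?_
  filter_upwards [eventually_gt_atTop 0] with n hn
  have hn1 : (1 : ℝ) ≤ n := by exact_mod_cast hn
  have hn' : (0 : ℝ) < n := by linarith
  rw [pow_one, coeff_I_eq, hsdef, map_sub, PowerSeries.coeff_C_mul, PowerSeries.coeff_one, if_neg hn.ne',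
    show (-(3 / 2) : ℝ) = (1 / 2 - 1) - 1 by norm_num, Real.rpow_sub_one hn'.ne' (1 / 2 - 1)]
  have h5 : (0:ℝ) < (n : ℝ) ^ ((1 : ℝ) / 2 - 1) := by positivity
  have h6 : (n : ℝ) + -1 / 2 ≠ 0 := by linarith
  generalize (n : ℝ) ^ ((1 : ℝ) / 2 - 1) = A at *
  generalize PowerSeries.coeff n (GG T 0) = y at *
  have hw : (n : ℝ) = (n + -1 / 2) + 1 / 2 := by ring
  generalize (n : ℝ) + -1 / 2 = w at *
  have h7 : 1 - 2 * (n : ℝ) = - 2 * w := by rw [hw]; ring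
  rw [h7]
  field_simp
  ring

lemma moment_limit {T : ℕ → Finset PTree}
    (hT : ∀ n : ℕ, ∀ t : PTree, t ∈ T n ↔ t.size = 2 * n + 1 ∧ t.validDeg {2})
    (k : ℕ) (hk1 : 1 ≤ k) (hk : k ≤ 7) :
    Tendsto (fun n : ℕ => SS T k n / (T n).card / (((n + 1 : ℕ) : ℝ) ^ (3 / 2 : ℝ)) ^ k) atTop
      (nhds (4 * √π * (gg k / Real.Gamma (((3 * k - 1 : ℕ) : ℝ) / 2)))) := by
  set s : PowerSeries ℝ := 1 - PowerSeries.C 2 * GG T 0 with hsdef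
  have hs := s_sq hT
  rw [← hsdef] at hs
  have hI := I_facts hs
  have hI0 : PowerSeries.coeff 0 (s - 2 * theta s) = 1 := by
    rw [coeff_I_eq]; simp [hsdef, GG]
  have hA := (Asy_main (GG T) (GG_rec hT) s hsdef hs k hk).tendsto hs hI hI0 (by omega)
  have hB := card_limit hT
  have hpi : (0:ℝ) < √π := by positivity
  have h1 := hA.div hB (by positivity)
  rw [show gg k / Real.Gamma (((3 * k - 1 : ℕ) : ℝ) / 2) / (1 / (4 * √π)) =
    4 * √π * (gg k / Real.Gamma (((3 * k - 1 : ℕ) : ℝ) / 2)) by rw [div_div_eq_mul_div, div_one]; ring] at h1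
  have h2 := (tendsto_add_atTop_iff_nat 1).2 h1
  refine h2.congr fun n => ?_
  have hn' : (0 : ℝ) < ((n + 1 : ℕ) : ℝ) := by positivity
  rw [Pi.div_apply, coeff_GG, coeff_GG, SS_card, ← Real.rpow_mul_natCast hn'.le]
  have e : (3 / 2 : ℝ) * k = (((3 * k - 1 : ℕ) : ℝ) / 2 - 1) - (-(3/2)) := by
    rw [Nat.cast_sub (by omega)]; push_cast; ring
  rw [e, Real.rpow_sub hn' (((3 * k - 1 : ℕ) : ℝ) / 2 - 1) (-(3/2))]
  have h5 : (0:ℝ) < ((n + 1 : ℕ) : ℝ) ^ (((3 * k - 1 : ℕ) : ℝ) / 2 - 1) := by positivity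
  have h6 : (0:ℝ) < ((n + 1 : ℕ) : ℝ) ^ (-(3/2) : ℝ) := by positivity
  generalize ((n + 1 : ℕ) : ℝ) ^ (((3 * k - 1 : ℕ) : ℝ) / 2 - 1) = A at *
  generalize ((n + 1 : ℕ) : ℝ) ^ (-(3/2) : ℝ) = B at *
  rw [mul_comm _ A, mul_comm _ B, ← div_div, ← div_div, div_div_div_cancel_right₀ (by positivity)]
  field_simp

lemma card_ne {T : ℕ → Finset PTree}
    (hT : ∀ n : ℕ, ∀ t : PTree, t ∈ T n ↔ t.size = 2 * n + 1 ∧ t.validDeg {2}) :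
    ∀ᶠ n in atTop, ((T n).card : ℝ) ≠ 0 := by
  have h := (tendsto_add_atTop_iff_nat 1).2 (card_limit hT)
  have hpi : (0:ℝ) < √π := by positivity
  have := h.eventually_ne (b₂ := 0) (by positivity)
  filter_upwards [this] with n hn h0
  rw [coeff_GG, SS_card, h0] at hn
  simp at hn

lemma Gamma_half (k : ℕ) : Real.Gamma (((2 * k + 1 : ℕ) : ℝ) / 2) = ((2 * k - 1 : ℕ).doubleFactorial : ℝ) * √π / 2 ^ k := by
  rw [← Real.Gamma_nat_add_half]
  congr 1; push_cast; ring

lemma Gamma_int (k : ℕ) : Real.Gamma (((2 * k + 2 : ℕ) : ℝ) / 2) = (k.factorial : ℝ) := by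
  rw [← Real.Gamma_nat_eq_factorial]
  congr 1; push_cast; ring

/-- Limits of the scaled raw moments. -/
lemma limits {T : ℕ → Finset PTree}
    (hT : ∀ n : ℕ, ∀ t : PTree, t ∈ T n ↔ t.size = 2 * n + 1 ∧ t.validDeg {2}) :
    ∃ R : ℕ → ℕ → ℝ, (∀ k n, R k n = SS T k n / (T n).card / (((n + 1 : ℕ) : ℝ) ^ (3 / 2 : ℝ)) ^ k) ∧
      Tendsto (R 1) atTop (nhds (2 * √π)) ∧ Tendsto (R 2) atTop (nhds (40 / 3)) ∧
      Tendsto (R 3) atTop (nhds (30 * √π)) ∧ Tendsto (R 4) atTop (nhds (14144 / 63)) ∧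
      Tendsto (R 5) atTop (nhds (565 * √π)) ∧ Tendsto (R 6) atTop (nhds (42406400 / 9009)) ∧
      Tendsto (R 7) atTop (nhds (39350 / 3 * √π)) := by
  have hpi : √π ≠ 0 := by positivity
  refine ⟨fun k n => SS T k n / (T n).card / (((n + 1 : ℕ) : ℝ) ^ (3 / 2 : ℝ)) ^ k, fun _ _ => rfl,
    ?_, ?_, ?_, ?_, ?_, ?_, ?_⟩
  · convert moment_limit hT 1 (by norm_num) (by norm_num) using 2
    have := Gamma_int 0
    norm_num at this ⊢
    norm_num [this, gg]; ring
  · convert moment_limit hT 2 (by norm_num) (by norm_num) using 2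
    have := Gamma_half 2
    norm_num [Nat.doubleFactorial] at this ⊢
    rw [this]; simp only [gg]; field_simp; norm_num
  · convert moment_limit hT 3 (by norm_num) (by norm_num) using 2
    have := Gamma_int 3
    rw [show 2 * 3 + 2 = 3 * 3 - 1 by norm_num] at this
    rw [this]; norm_num [gg, Nat.factorial]; ring
  · convert moment_limit hT 4 (by norm_num) (by norm_num) using 2
    have := Gamma_half 5
    norm_num [Nat.doubleFactorial] at this ⊢
    rw [this]; simp only [gg]; field_simp; norm_num
  · convert moment_limit hT 5 (by norm_num) (by norm_num) using 2
    have := Gamma_int 6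
    rw [show 2 * 6 + 2 = 3 * 5 - 1 by norm_num] at this
    rw [this]; norm_num [gg, Nat.factorial]; ring
  · convert moment_limit hT 6 (by norm_num) (by norm_num) using 2
    have := Gamma_half 8
    norm_num [Nat.doubleFactorial] at this ⊢
    rw [this]; simp only [gg]; field_simp; norm_num
  · convert moment_limit hT 7 (by norm_num) (by norm_num) using 2
    have := Gamma_int 9
    rw [show 2 * 9 + 2 = 3 * 7 - 1 by norm_num] at this
    rw [this]; norm_num [gg, Nat.factorial]; ring

lemma central2 (T : ℕ → Finset PTree) (n : ℕ) (u : ℝ) :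
    ∑ t ∈ T n, ((t.totalHeight : ℝ) - u) ^ 2 = SS T 2 n + (-2 * u) * SS T 1 n + u ^ 2 * SS T 0 n := by
  unfold SS
  rw [Finset.mul_sum, Finset.mul_sum, ← Finset.sum_add_distrib, ← Finset.sum_add_distrib]
  exact Finset.sum_congr rfl fun t _ => by ring

lemma central7 (T : ℕ → Finset PTree) (n : ℕ) (u : ℝ) :
    ∑ t ∈ T n, ((t.totalHeight : ℝ) - u) ^ 7 = SS T 7 n + (-7 * u) * SS T 6 n + (21 * u ^ 2) * SS T 5 n
      + (-35 * u ^ 3) * SS T 4 n + (35 * u ^ 4) * SS T 3 n + (-21 * u ^ 5) * SS T 2 n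
      + (7 * u ^ 6) * SS T 1 n + (-u ^ 7) * SS T 0 n := by
  unfold SS
  simp only [Finset.mul_sum, ← Finset.sum_add_distrib]
  exact Finset.sum_congr rfl fun t _ => by ring

end TH

/-- Let `H_n` be the total height (sum over all vertices of the distance to the root) on
complete binary trees with `2n+1` vertices, under the uniform distribution; with mean
`μ n`, central moments `m i n`, and scaled moments `α i n = m i n / (m 2 n)^(i/2)`,
the `7`-th scaled moment converges as `n → ∞` to the stated constant. -/
theorem totalheight_stmt11 (T : ℕ → Finset PTree)
    (hT : ∀ n : ℕ, ∀ t : PTree, t ∈ T n ↔ t.size = 2 * n + 1 ∧ t.validDeg {2})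
    (μ : ℕ → ℝ)
    (hμ : ∀ n : ℕ, μ n = (∑ t ∈ T n, (t.totalHeight : ℝ)) / ((T n).card : ℝ))
    (m : ℕ → ℕ → ℝ)
    (hm : ∀ i n : ℕ, m i n =
      (∑ t ∈ T n, ((t.totalHeight : ℝ) - μ n) ^ i) / ((T n).card : ℝ))
    (α : ℕ → ℕ → ℝ)
    (hα : ∀ i n : ℕ, α i n = m i n / (m 2 n) ^ ((i : ℝ) / 2)) :
    Tendsto (fun n : ℕ => α 7 n) atTop
      (nhds ((162 * π ^ 3 + (6615 / 4) * π ^ 2 - (103965 / 32) * π - 101897475 / 9152) * Real.sqrt 3 * Real.sqrt (π / (10 - 3 * π)) / (10 - 3 * π) ^ 3)) := by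
  obtain ⟨R, hR, h1, h2, h3, h4, h5, h6, h7⟩ := TH.limits hT
  have hpi3 : 3 * π < 10 := by have := Real.pi_lt_d2; linarith
  have hpi0 := Real.pi_pos
  have hsq : √π ^ 2 = π := Real.sq_sqrt hpi0.le
  -- limits of the scaled central moments
  have hv : Tendsto (fun n => R 2 n - R 1 n ^ 2) atTop (nhds (4 / 3 * (10 - 3 * π))) := by
    convert h2.sub (h1.pow 2) using 2
    rw [mul_pow, hsq]; ring
  have hc : Tendsto (fun n => R 7 n - 7 * (R 1 n * R 6 n) + 21 * (R 1 n ^ 2 * R 5 n)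
      - 35 * (R 1 n ^ 3 * R 4 n) + 35 * (R 1 n ^ 4 * R 3 n) - 21 * (R 1 n ^ 5 * R 2 n) + 6 * R 1 n ^ 7)
      atTop (nhds (√π * (39350 / 3 - 14 * (42406400 / 9009) + 84 * π * 565 - 280 * π * (14144 / 63)
        + 560 * π ^ 2 * 30 - 672 * π ^ 2 * (40 / 3) + 768 * π ^ 3))) := by
    convert ((((((h7.sub ((h1.mul h6).const_mul 7)).add (((h1.pow 2).mul h5).const_mul 21)).sub
      (((h1.pow 3).mul h4).const_mul 35)).add (((h1.pow 4).mul h3).const_mul 35)).sub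
      (((h1.pow 5).mul h2).const_mul 21)).add ((h1.pow 7).const_mul 6)) using 2
    generalize √π = q at *
    rw [← hsq]; ring
  have hvpos : (0 : ℝ) < 4 / 3 * (10 - 3 * π) := by linarith
  have hfin := hc.div (hv.rpow_const (p := (7 : ℝ) / 2) (Or.inl hvpos.ne')) (by positivity)
  have hval : √π * (39350 / 3 - 14 * (42406400 / 9009) + 84 * π * 565 - 280 * π * (14144 / 63)
        + 560 * π ^ 2 * 30 - 672 * π ^ 2 * (40 / 3) + 768 * π ^ 3) / (4 / 3 * (10 - 3 * π)) ^ ((7 : ℝ) / 2)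
      = (162 * π ^ 3 + (6615 / 4) * π ^ 2 - (103965 / 32) * π - 101897475 / 9152) * Real.sqrt 3 * Real.sqrt (π / (10 - 3 * π)) / (10 - 3 * π) ^ 3 := by
    have hw : 0 < 10 - 3 * π := by linarith
    have e1 : (4 / 3 * (10 - 3 * π)) ^ ((7 : ℝ) / 2) =
        (4 / 3 * (10 - 3 * π)) ^ 3 * (2 * √(10 - 3 * π) / √3) := by
      rw [show (7 : ℝ) / 2 = (3 : ℕ) + 1 / 2 by norm_num, Real.rpow_add hvpos, Real.rpow_natCast,
        ← Real.sqrt_eq_rpow, Real.sqrt_mul (by norm_num), Real.sqrt_div (by norm_num),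
        show (4 : ℝ) = 2 ^ 2 by norm_num, Real.sqrt_sq (by norm_num)]
      ring
    rw [e1, Real.sqrt_div hpi0.le]
    have hw' : 0 < √(10 - 3 * π) := Real.sqrt_pos.2 hw
    have h3' : 0 < √(3:ℝ) := by positivity
    generalize √π = q at *
    generalize √(10 - 3 * π) = r at *
    generalize √(3:ℝ) = z at *
    have hw0 := hw.ne'
    generalize hW : 10 - 3 * π = w at *
    field_simp
    ring
  rw [hval] at hfin
  refine hfin.congr' ?_
  filter_upwards [TH.card_ne hT] with n hcard
  rw [Pi.div_apply, hα]
  have hL : (0 : ℝ) < ((n + 1 : ℕ) : ℝ) ^ (3 / 2 : ℝ) := by positivity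
  have hR' : ∀ k, TH.SS T k n = R k n * (T n).card * (((n + 1 : ℕ) : ℝ) ^ (3 / 2 : ℝ)) ^ k := by
    intro k
    rw [hR]; field_simp
  have hμ' : μ n = R 1 n * ((n + 1 : ℕ) : ℝ) ^ (3 / 2 : ℝ) := by
    rw [hμ, hR]
    simp only [TH.SS, pow_one]
    field_simp
  have hm2 : m 2 n = (R 2 n - R 1 n ^ 2) * (((n + 1 : ℕ) : ℝ) ^ (3 / 2 : ℝ)) ^ 2 := by
    rw [hm, TH.central2, hR' 2, hR' 1, TH.SS_card, hμ']
    field_simp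
    ring
  have hm7 : m 7 n = (R 7 n - 7 * (R 1 n * R 6 n) + 21 * (R 1 n ^ 2 * R 5 n)
      - 35 * (R 1 n ^ 3 * R 4 n) + 35 * (R 1 n ^ 4 * R 3 n) - 21 * (R 1 n ^ 5 * R 2 n) + 6 * R 1 n ^ 7)
      * (((n + 1 : ℕ) : ℝ) ^ (3 / 2 : ℝ)) ^ 7 := by
    rw [hm, TH.central7, hR' 7, hR' 6, hR' 5, hR' 4, hR' 3, hR' 2, hR' 1, TH.SS_card, hμ']
    field_simp
    ring
  have hm2n : 0 ≤ m 2 n := by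
    rw [hm]
    exact div_nonneg (Finset.sum_nonneg fun t _ => sq_nonneg _) (Nat.cast_nonneg _)
  generalize ((n + 1 : ℕ) : ℝ) ^ (3 / 2 : ℝ) = L at *
  have hv0 : 0 ≤ R 2 n - R 1 n ^ 2 := by
    rw [hm2] at hm2n
    exact nonneg_of_mul_nonneg_left hm2n (by positivity)
  have hLp : (L ^ 2) ^ ((7 : ℝ) / 2) = L ^ 7 := by
    rw [← Real.rpow_natCast L 2, ← Real.rpow_mul hL.le, ← Real.rpow_natCast L 7]
    norm_num
  rw [hm7, hm2, Nat.cast_ofNat, Real.mul_rpow hv0 (by positivity), hLp, mul_div_mul_right _ _ (by positivity)]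
end

section
/- For n ≥ 1, let H_n be the random variable 'total height' (sum over all vertices of the distance to the root) on the set of complete binary trees with 2n+1 vertices, equipped with the uniform distribution. Let μ(n) = E[H_n], m_i(n) = E[(H_n − μ(n))^i], and α_i(n) = m_i(n)/m_2(n)^{i/2}. Then lim_{n→∞} α_9(n) = (648π⁴ + 15795π³ + (591867/16)π² − (461286225/2288)π − 188411947088175/662165504)·√3·√(π/(10 − 3π)) / (10 − 3π)⁴ ≈ 1460.7011342971821…. -/
namespace TH

open PowerSeries Filter Topology

/-- The power series `(1 - 4 X) ^ (-r)`. -/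
noncomputable def Bs (r : ℝ) : PowerSeries ℝ :=
  rescale (-4 : ℝ) (binomialSeries ℝ (-r))

theorem Bs_add (r t : ℝ) : Bs (r + t) = Bs r * Bs t := by
  unfold Bs
  rw [neg_add, binomialSeries_add, map_mul]

theorem Bs_zero : Bs 0 = 1 := by
  unfold Bs
  rw [neg_zero, binomialSeries_zero, map_one]

theorem Bs_neg_one : Bs (-1) = 1 - PowerSeries.C 4 * X := by
  unfold Bs
  have h := binomialSeries_nat (R := ℝ) (A := ℝ) 1
  rw [neg_neg, show (1 : ℝ) = ((1 : ℕ) : ℝ) by simp, h]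
  ext n
  simp only [coeff_rescale, pow_one, map_add, map_sub, coeff_C_mul, coeff_one, coeff_X]
  rcases n with _ | _ | n <;> simp

theorem Bs_coeff (r : ℝ) (n : ℕ) :
    coeff n (Bs r) = 4 ^ n * (∏ j ∈ Finset.range n, (r + j)) / n.factorial := by
  unfold Bs
  have h1 := Ring.factorial_nsmul_multichoose_eq_ascPochhammer r n
  have h2 : (ascPochhammer ℕ n).smeval r = ∏ j ∈ Finset.range n, (r + j) := by
    clear h1
    induction n with
    | zero => simp
    | succ n ih =>
      rw [Finset.prod_range_succ, ← ih, ascPochhammer_succ_right, Polynomial.smeval_mul]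
      rw [Polynomial.smeval_add, Polynomial.smeval_X, Polynomial.smeval_natCast]
      simp
  rw [coeff_rescale, binomialSeries_coeff, Ring.choose_neg', smul_eq_mul, mul_one]
  rw [h2, nsmul_eq_mul] at h1
  rw [← h1]
  have : (n.factorial : ℝ) ≠ 0 := by positivity
  field_simp
  rw [Units.smul_def, ← Int.cast_smul_eq_zsmul ℝ, Int.cast_negOnePow_natCast, smul_eq_mul, ← mul_assoc, ← mul_pow]
  norm_num

theorem Bs_tendsto (r : ℝ) (hr : ∀ k : ℕ, r ≠ -k) :
    Tendsto (fun n : ℕ => coeff n (Bs r) / (4 ^ n * (n : ℝ) ^ (r - 1))) atTop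
      (𝓝 (Real.Gamma r)⁻¹) := by
  have h1 := (Real.GammaSeq_tendsto_Gamma r).inv₀ (Real.Gamma_ne_zero hr)
  have h2 : Tendsto (fun n : ℕ => (n : ℝ) / (n + r)) atTop (𝓝 1) :=
    tendsto_natCast_div_add_atTop r
  have h3 := h1.mul h2
  rw [mul_one] at h3
  refine h3.congr' ?_
  filter_upwards [eventually_gt_atTop 0] with n hn
  have hn' : (0 : ℝ) < n := by exact_mod_cast hn
  have hne : (n : ℝ) + r ≠ 0 := fun h => hr n (by linarith)
  have hp : ∏ j ∈ Finset.range n, (r + j) ≠ 0 :=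
    Finset.prod_ne_zero_iff.2 fun j _ h => hr j (by linarith)
  rw [Bs_coeff, Real.GammaSeq, Finset.prod_range_succ, Real.rpow_sub_one hn'.ne']
  have : (n.factorial : ℝ) ≠ 0 := by positivity
  have : (n : ℝ) ^ r ≠ 0 := by positivity
  have hne' : r + (n : ℝ) ≠ 0 := by rwa [add_comm]
  field_simp
  ring

theorem Bs_lim (r : ℝ) : ∃ L : ℝ,
    Tendsto (fun n : ℕ => coeff n (Bs r) / (4 ^ n * (n : ℝ) ^ (r - 1))) atTop (𝓝 L) := by
  by_cases hr : ∀ k : ℕ, r ≠ -k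
  · exact ⟨_, Bs_tendsto r hr⟩
  · push Not at hr
    obtain ⟨k, hk⟩ := hr
    refine ⟨0, tendsto_const_nhds.congr' ?_⟩
    filter_upwards [eventually_gt_atTop k] with n hn
    rw [Bs_coeff, Finset.prod_eq_zero (Finset.mem_range.2 hn) (by rw [hk]; ring)]
    simp

/-- The square root `√(1 - 4 X)`. -/
noncomputable def sq : PowerSeries ℝ := Bs (-(1 / 2))

theorem sq_pow (m : ℕ) : sq ^ m = Bs (-(m / 2 : ℝ)) := by
  induction m with
  | zero => simp [Bs_zero]
  | succ m ih =>
    rw [pow_succ, ih, sq, ← Bs_add]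
    congr 1; push_cast; ring

theorem sq_sq : sq ^ 2 = 1 - PowerSeries.C 4 * X := by
  rw [sq_pow, ← Bs_neg_one]; congr 1; norm_num

theorem sq_pow_mul (m : ℕ) : sq ^ m * Bs (m / 2 : ℝ) = 1 := by
  rw [sq_pow, ← Bs_add, neg_add_cancel, Bs_zero]

theorem sq_pow_ne (m : ℕ) : sq ^ m ≠ 0 := by
  intro h
  have := sq_pow_mul m
  rw [h, zero_mul] at this
  exact zero_ne_one this

/-- `f` is a Laurent polynomial in `sq` with lowest term `a * sq ^ (-m)`. -/
def Lau (m : ℕ) (a : ℝ) (f : PowerSeries ℝ) : Prop :=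
  ∃ p : Polynomial ℝ, f * sq ^ m = Polynomial.aeval sq p ∧ p.eval 0 = a

theorem Lau.mul {m m' : ℕ} {a b : ℝ} {f g : PowerSeries ℝ} (hf : Lau m a f) (hg : Lau m' b g) :
    Lau (m + m') (a * b) (f * g) := by
  obtain ⟨p, hp, rfl⟩ := hf
  obtain ⟨q, hq, rfl⟩ := hg
  refine ⟨p * q, ?_, by simp⟩
  rw [map_mul, ← hp, ← hq]; ring

theorem Lau.add {m : ℕ} {a b : ℝ} {f g : PowerSeries ℝ} (hf : Lau m a f) (hg : Lau m b g) :
    Lau m (a + b) (f + g) := by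
  obtain ⟨p, hp, rfl⟩ := hf
  obtain ⟨q, hq, rfl⟩ := hg
  refine ⟨p + q, ?_, by simp⟩
  rw [map_add, ← hp, ← hq]; ring

theorem Lau.zero (m : ℕ) : Lau m 0 0 := ⟨0, by simp, by simp⟩

theorem Lau.sum {ι : Type} (t : Finset ι) {m : ℕ} {a : ι → ℝ} {f : ι → PowerSeries ℝ}
    (h : ∀ i ∈ t, Lau m (a i) (f i)) : Lau m (∑ i ∈ t, a i) (∑ i ∈ t, f i) := by
  classical
  induction t using Finset.induction_on with
  | empty => simpa using Lau.zero m
  | insert i t hi ih =>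
    rw [Finset.sum_insert hi, Finset.sum_insert hi]
    exact (h i (Finset.mem_insert_self _ _)).add
      (ih fun j hj => h j (Finset.mem_insert_of_mem hj))

theorem Lau.smul {m : ℕ} {a : ℝ} {f : PowerSeries ℝ} (c : ℝ) (hf : Lau m a f) :
    Lau m (c * a) (c • f) := by
  obtain ⟨p, hp, rfl⟩ := hf
  refine ⟨c • p, ?_, by simp⟩
  rw [map_smul, ← hp, smul_mul_assoc]

theorem Lau.lift {m m' : ℕ} {a : ℝ} {f : PowerSeries ℝ} (hf : Lau m a f) (h : m < m') :
    Lau m' 0 f := by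
  obtain ⟨p, hp, rfl⟩ := hf
  obtain ⟨k, rfl⟩ := Nat.exists_eq_add_of_lt h
  refine ⟨p * Polynomial.X ^ (k + 1), ?_, by simp⟩
  rw [map_mul, ← hp]; simp; ring

theorem Lau.div {m : ℕ} {a : ℝ} {f : PowerSeries ℝ} (hf : Lau m a (sq * f)) :
    Lau (m + 1) a f := by
  obtain ⟨p, hp, rfl⟩ := hf
  refine ⟨p, ?_, rfl⟩
  rw [← hp]; ring

/-- The operator `X d/dX`. -/
noncomputable def th (f : PowerSeries ℝ) : PowerSeries ℝ := X * derivative ℝ f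

theorem th_coeff (f : PowerSeries ℝ) (n : ℕ) : coeff n (th f) = n * coeff n f := by
  unfold th
  cases n with
  | zero => simp
  | succ n => rw [coeff_succ_X_mul, coeff_derivative]; push_cast; ring

theorem th_iter_coeff (f : PowerSeries ℝ) (c n : ℕ) :
    coeff n (th^[c] f) = n ^ c * coeff n f := by
  induction c with
  | zero => simp
  | succ c ih => rw [Function.iterate_succ_apply', th_coeff, ih]; ring

theorem th_mul (f g : PowerSeries ℝ) : th (f * g) = f * th g + g * th f := by
  unfold th
  rw [Derivation.leibniz, smul_eq_mul, smul_eq_mul]; ring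

theorem th_sq : PowerSeries.C 2 * (sq * th sq) = sq ^ 2 - 1 := by
  have h : th (sq ^ 2) = - (PowerSeries.C 4 * X) := by
    rw [sq_sq]; unfold th; simp [Derivation.leibniz]; ring
  rw [pow_two, th_mul] at h
  rw [sq_sq, show PowerSeries.C (2 : ℝ) = 2 by rfl]
  linear_combination h

theorem th_pow (m : ℕ) : sq * th (sq ^ m) = (m : PowerSeries ℝ) * sq ^ m * th sq := by
  induction m with
  | zero => simp [th]
  | succ m ih => rw [pow_succ, th_mul, mul_add, show sq * (sq * th (sq ^ m)) = sq * (sq * th (sq^m)) from rfl, ih]; push_cast; ring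

theorem th_aeval (p : Polynomial ℝ) :
    th (Polynomial.aeval sq p) = Polynomial.aeval sq (Polynomial.derivative p) * th sq := by
  unfold th
  have := (PowerSeries.derivative ℝ).map_aeval p sq
  rw [this, smul_eq_mul]; ring

theorem Lau.th {m : ℕ} {a : ℝ} {f : PowerSeries ℝ} (hf : Lau m a f) :
    Lau (m + 2) (m / 2 * a) (th f) := by
  obtain ⟨p, hp, rfl⟩ := hf
  refine ⟨Polynomial.C (1/2) * (Polynomial.derivative p * Polynomial.X * (Polynomial.X ^ 2 - 1)
    - Polynomial.C (m : ℝ) * p * (Polynomial.X ^ 2 - 1)), ?_, by simp; ring⟩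
  have h1 := congrArg TH.th hp
  rw [th_aeval, th_mul] at h1
  have h2 := th_pow m
  have h3 := th_sq
  have h4 : PowerSeries.C (1/2 : ℝ) * PowerSeries.C 2 = 1 := by
    rw [← map_mul]; norm_num
  have h5 : (Polynomial.aeval sq) (Polynomial.C (m : ℝ)) = (m : PowerSeries ℝ) := by simp
  have h6 : (Polynomial.aeval sq) (Polynomial.C (1/2 : ℝ)) = PowerSeries.C (1/2 : ℝ) := by
    rw [Polynomial.aeval_C]; rfl
  simp only [map_mul, map_sub, map_pow, Polynomial.aeval_X, map_one, h5, h6, ← hp, ← h3]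
  generalize (PowerSeries.C (1/2 : ℝ)) = u at *
  generalize (PowerSeries.C (2 : ℝ)) = v at *
  generalize TH.th (sq ^ m) = w at *
  generalize (Polynomial.aeval sq) (Polynomial.derivative p) = d at *
  linear_combination sq ^ 2 * h1 - f * sq * h2 + (-(d * sq ^2 * TH.th sq) + m * f * sq^m * sq * TH.th sq) * h4

theorem Lau.th_iter {m : ℕ} {a : ℝ} {f : PowerSeries ℝ} (hf : Lau m a f) (c : ℕ) :
    ∃ b, Lau (m + 2 * c) b (TH.th^[c] f) := by
  induction c with
  | zero => exact ⟨a, by simpa using hf⟩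
  | succ c ih =>
    obtain ⟨b, hb⟩ := ih
    rw [Function.iterate_succ_apply']
    exact ⟨_, hb.th⟩

theorem Lau.tendsto {m : ℕ} (hm : 1 ≤ m) {a : ℝ} {f : PowerSeries ℝ} (hf : Lau m a f) :
    Tendsto (fun n : ℕ => coeff n f / (4 ^ n * (n : ℝ) ^ ((m : ℝ) / 2 - 1))) atTop
      (𝓝 (a * (Real.Gamma (m / 2))⁻¹)) := by
  obtain ⟨p, hp, rfl⟩ := hf
  have hf : f = ∑ j ∈ Finset.range (p.natDegree + 1), p.coeff j • Bs ((m : ℝ) / 2 - j / 2) := by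
    have h : f = f * sq ^ m * Bs (m / 2 : ℝ) := by rw [mul_assoc, sq_pow_mul, mul_one]
    rw [h, hp, Polynomial.aeval_eq_sum_range, Finset.sum_mul]
    refine Finset.sum_congr rfl fun j _ => ?_
    rw [smul_mul_assoc, sq_pow, ← Bs_add]
    congr 2; ring
  rw [Finset.sum_range_succ'] at hf
  have h0 : Tendsto (fun n : ℕ => coeff n (Bs ((m : ℝ) / 2)) / (4 ^ n * (n : ℝ) ^ ((m : ℝ) / 2 - 1)))
      atTop (𝓝 (Real.Gamma (m / 2))⁻¹) := by
    apply Bs_tendsto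
    intro k hk
    have : (1 : ℝ) ≤ m := by exact_mod_cast hm
    have : (0 : ℝ) ≤ k := by positivity
    linarith
  have h1 : ∀ j : ℕ, Tendsto (fun n : ℕ => coeff n (Bs ((m : ℝ) / 2 - (j + 1 : ℕ) / 2)) /
      (4 ^ n * (n : ℝ) ^ ((m : ℝ) / 2 - 1))) atTop (𝓝 0) := by
    intro j
    obtain ⟨c, hc⟩ := Bs_lim ((m : ℝ) / 2 - (j + 1 : ℕ) / 2)
    have hj : (0 : ℝ) < ((j + 1 : ℕ) : ℝ) / 2 := by positivity
    have h2 := (tendsto_rpow_neg_atTop hj).comp (tendsto_natCast_atTop_atTop (R := ℝ))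
    have h3 := hc.mul h2
    rw [mul_zero] at h3
    refine h3.congr' ?_
    filter_upwards [eventually_gt_atTop 0] with n hn
    have hn' : (0 : ℝ) < n := by exact_mod_cast hn
    simp only [Function.comp_apply]
    rw [show (m : ℝ) / 2 - 1 = ((m : ℝ) / 2 - (j + 1 : ℕ) / 2 - 1) + (j + 1 : ℕ) / 2 by ring,
      Real.rpow_add hn', Real.rpow_neg hn'.le]
    field_simp
  have h2 := (tendsto_finsetSum (Finset.range p.natDegree)
    fun j _ => (h1 j).const_mul (p.coeff (j + 1))).add (h0.const_mul (p.coeff 0))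
  simp only [mul_zero, Finset.sum_const_zero, zero_add] at h2
  rw [Polynomial.coeff_zero_eq_eval_zero] at h2
  refine h2.congr fun n => ?_
  conv_rhs => rw [hf]
  simp only [map_add, map_sum, coeff_smul, smul_eq_mul, Finset.sum_div, add_div,
    Polynomial.coeff_zero_eq_eval_zero]
  simp [mul_div_assoc]

end TH

namespace TH

open PowerSeries Filter Topology BinaryTree

/-- External path length of a binary tree. -/
def epl : BinaryTree Unit → ℕ
  | .nil => 0
  | .node _ l r => epl l + epl r + (numLeaves l + numLeaves r)

theorem sum_trees_succ (n : ℕ) (φ : BinaryTree Unit → ℝ) :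
    ∑ t ∈ treesOfNumNodesEq (n + 1), φ t =
      ∑ ij ∈ Finset.HasAntidiagonal.antidiagonal n, ∑ l ∈ treesOfNumNodesEq ij.1, ∑ r ∈ treesOfNumNodesEq ij.2,
        φ (.node () l r) := by
  rw [treesOfNumNodesEq_succ, Finset.sum_biUnion]
  · refine Finset.sum_congr rfl fun ij _ => ?_
    rw [pairwiseNode, Finset.sum_map, Finset.sum_product]
    rfl
  · simp_rw [Set.PairwiseDisjoint, Set.Pairwise, Function.onFun, Finset.disjoint_left]
    rintro ⟨i, j⟩ _ ⟨i2, j2⟩ _ hne t ht ht'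
    simp only [pairwiseNode, Finset.mem_map, Finset.mem_product, mem_treesOfNumNodesEq] at ht ht'
    obtain ⟨⟨a, b⟩, ⟨h1, h2⟩, rfl⟩ := ht
    obtain ⟨⟨c, d⟩, ⟨h3, h4⟩, h5⟩ := ht'
    simp at h1 h2 h3 h4 h5
    apply hne
    rw [← h1, ← h2, ← h3, ← h4, h5.1, h5.2]

/-- Moment generating coefficients by number of internal nodes. -/
noncomputable def Gp (k : ℕ) : PowerSeries ℝ :=
  PowerSeries.mk fun n => ∑ t ∈ treesOfNumNodesEq n, (epl t : ℝ) ^ k / k.factorial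

/-- Moment generating coefficients by number of leaves. -/
noncomputable def G (k : ℕ) : PowerSeries ℝ := X * Gp k

/-- Convolution squares. -/
noncomputable def S (d : ℕ) : PowerSeries ℝ := ∑ p ∈ Finset.HasAntidiagonal.antidiagonal d, G p.1 * G p.2

theorem S_eq (d : ℕ) : S d = X ^ 2 * ∑ p ∈ Finset.HasAntidiagonal.antidiagonal d, Gp p.1 * Gp p.2 := by
  unfold S G
  rw [Finset.mul_sum]
  exact Finset.sum_congr rfl fun p _ => by ring

theorem exp_add (x y : ℝ) (k : ℕ) : (x + y) ^ k / k.factorial =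
    ∑ p ∈ Finset.HasAntidiagonal.antidiagonal k, x ^ p.1 / p.1.factorial * (y ^ p.2 / p.2.factorial) := by
  rw [add_pow, Finset.sum_div, Finset.Nat.sum_antidiagonal_eq_sum_range_succ
    (fun a b => x ^ a / a.factorial * (y ^ b / b.factorial))]
  refine Finset.sum_congr rfl fun i hi => ?_
  have hi' : i ≤ k := by simpa [Nat.lt_succ_iff] using hi
  rw [Nat.cast_choose ℝ hi']
  have h1 : (k.factorial : ℝ) ≠ 0 := by positivity
  have h2 : (i.factorial : ℝ) ≠ 0 := by positivity
  have h3 : ((k - i).factorial : ℝ) ≠ 0 := by positivity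
  field_simp

theorem sum_rec (n k : ℕ) :
    ∑ t ∈ treesOfNumNodesEq (n + 1), (epl t : ℝ) ^ k / k.factorial =
      ∑ q ∈ Finset.HasAntidiagonal.antidiagonal k, ((n + 2 : ℕ) : ℝ) ^ q.1 / q.1.factorial *
        ∑ p ∈ Finset.HasAntidiagonal.antidiagonal q.2, coeff n (Gp p.1 * Gp p.2) := by
  rw [sum_trees_succ]
  have h1 : ∀ ij ∈ Finset.HasAntidiagonal.antidiagonal n, ∑ l ∈ treesOfNumNodesEq ij.1,
      ∑ r ∈ treesOfNumNodesEq ij.2, (epl (.node () l r) : ℝ) ^ k / k.factorial =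
      ∑ q ∈ Finset.HasAntidiagonal.antidiagonal k, ((n + 2 : ℕ) : ℝ) ^ q.1 / q.1.factorial *
        ∑ p ∈ Finset.HasAntidiagonal.antidiagonal q.2, coeff ij.1 (Gp p.1) * coeff ij.2 (Gp p.2) := by
    intro ij hij
    have h2 : ∀ l ∈ treesOfNumNodesEq ij.1, ∀ r ∈ treesOfNumNodesEq ij.2,
        (epl (.node () l r) : ℝ) ^ k / k.factorial =
        ∑ q ∈ Finset.HasAntidiagonal.antidiagonal k, ((n + 2 : ℕ) : ℝ) ^ q.1 / q.1.factorial *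
          ∑ p ∈ Finset.HasAntidiagonal.antidiagonal q.2, (epl l : ℝ) ^ p.1 / p.1.factorial *
            ((epl r : ℝ) ^ p.2 / p.2.factorial) := by
      intro l hl r hr
      rw [mem_treesOfNumNodesEq] at hl hr
      rw [Finset.HasAntidiagonal.mem_antidiagonal] at hij
      have h3 : epl (.node () l r) = (n + 2) + (epl l + epl r) := by
        rw [epl, numLeaves_eq_numNodes_succ, numLeaves_eq_numNodes_succ]; omega
      rw [h3, Nat.cast_add, exp_add]
      refine Finset.sum_congr rfl fun q _ => ?_
      rw [Nat.cast_add (epl l), exp_add]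
    rw [Finset.sum_congr rfl fun l hl => Finset.sum_congr rfl fun r hr => h2 l hl r hr]
    simp only [Gp, coeff_mk, Finset.sum_mul_sum]
    simp only [Finset.mul_sum]
    rw [Finset.sum_congr rfl fun l _ => Finset.sum_comm, Finset.sum_comm]
    refine Finset.sum_congr rfl fun q _ => ?_
    rw [Finset.sum_congr rfl fun l _ => Finset.sum_comm, Finset.sum_comm]
  rw [Finset.sum_congr rfl h1, Finset.sum_comm]
  refine Finset.sum_congr rfl fun q _ => ?_
  rw [← Finset.mul_sum, Finset.sum_comm]
  simp only [coeff_mul]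

theorem G_rec (k : ℕ) : G k = (if k = 0 then X else 0) +
    ∑ q ∈ Finset.HasAntidiagonal.antidiagonal k, (1 / (q.1.factorial : ℝ)) • th^[q.1] (S q.2) := by
  ext N
  simp only [map_add, map_sum, coeff_smul, th_iter_coeff, S_eq, smul_eq_mul]
  rcases N with _ | _ | n
  · have : coeff 0 (if k = 0 then X else 0 : PowerSeries ℝ) = 0 := by split_ifs <;> simp
    rw [this]
    simp [G]
  · have h : ∀ f : PowerSeries ℝ, coeff (0 + 1) (X ^ 2 * f) = 0 := by
      intro f
      rw [pow_two, mul_assoc, coeff_succ_X_mul]; simp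
    simp only [h, mul_zero, Finset.sum_const_zero, add_zero]
    rw [G, coeff_succ_X_mul, Gp, coeff_mk]
    by_cases hk : k = 0
    · simp [hk]
    · simp [hk, epl]
  · have h : ∀ f : PowerSeries ℝ, coeff (n + 1 + 1) (X ^ 2 * f) = coeff n f := by
      intro f
      rw [pow_two, mul_assoc, coeff_succ_X_mul, coeff_succ_X_mul]
    have h0 : coeff (n + 1 + 1) (if k = 0 then X else 0 : PowerSeries ℝ) = 0 := by
      split_ifs <;> simp [coeff_X]
    simp only [h, h0, zero_add]
    rw [G, coeff_succ_X_mul, Gp, coeff_mk, sum_rec]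
    refine Finset.sum_congr rfl fun q _ => ?_
    rw [map_sum]; ring

theorem S_zero : S 0 = G 0 * G 0 := by simp [S]

theorem constCoeff_sq : constantCoeff sq = 1 := by
  rw [← coeff_zero_eq_constantCoeff_apply, sq, Bs_coeff]; simp

theorem sq_eq : sq = 1 - 2 * G 0 := by
  have h := G_rec 0
  simp [S_zero] at h
  have h4 : PowerSeries.C (4 : ℝ) = 4 := rfl
  have h1 : (sq - (1 - 2 * G 0)) * (sq + (1 - 2 * G 0)) = 0 := by
    have := sq_sq
    rw [h4] at this
    linear_combination this + 4 * h
  rcases mul_eq_zero.1 h1 with h2 | h2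
  · exact sub_eq_zero.1 h2
  · exfalso
    have := congrArg constantCoeff h2
    have h5 : constantCoeff (G 0) = 0 := by simp [G]
    rw [map_add, map_sub, map_mul, h5, constCoeff_sq] at this
    norm_num at this

theorem G_zero : G 0 = (1 / 2 : ℝ) • (1 - sq) := by
  rw [sq_eq, smul_eq_C_mul]
  have h4 : PowerSeries.C (1 / 2 : ℝ) * 2 = 1 := by
    rw [show (2 : PowerSeries ℝ) = PowerSeries.C 2 from rfl, ← map_mul]; norm_num
  linear_combination -(G 0) * h4

theorem Lau_one : Lau 0 1 1 := ⟨1, by simp, by simp⟩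

theorem Lau_sq : Lau 0 0 sq := ⟨Polynomial.X, by simp, by simp⟩

theorem Lau_G_zero : Lau 0 (1 / 2) (G 0) := by
  have := (Lau_one.add (Lau_sq.smul (-1))).smul (1 / 2)
  rw [G_zero]
  convert this using 1
  · norm_num
  · simp [sub_eq_add_neg]

theorem Lau_thS : Lau 1 (1 / 4) (th (S 0)) := by
  refine ⟨Polynomial.C (1/4) * (Polynomial.X - 1) * (Polynomial.X ^ 2 - 1), ?_, by simp⟩
  have h4 : PowerSeries.C (1 / 2 : ℝ) * 2 = 1 := by
    rw [show (2 : PowerSeries ℝ) = PowerSeries.C 2 from rfl, ← map_mul]; norm_num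
  have h5 : PowerSeries.C (1 / 4 : ℝ) = PowerSeries.C (1 / 2 : ℝ) * PowerSeries.C (1 / 2 : ℝ) := by
    rw [← map_mul]; norm_num
  have h6 : (Polynomial.aeval sq) (Polynomial.C (1/4 : ℝ)) = PowerSeries.C (1/4 : ℝ) := by
    rw [Polynomial.aeval_C]; rfl
  have h7 : th (G 0) = - (PowerSeries.C (1 / 2 : ℝ) * th sq) := by
    rw [G_zero, th, th]; simp [smul_eq_C_mul]; ring
  have h3 := th_sq
  rw [show PowerSeries.C (2 : ℝ) = 2 from rfl] at h3
  rw [S_zero, th_mul, h7, G_zero, smul_eq_C_mul]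
  simp only [map_mul, map_sub, map_pow, Polynomial.aeval_X, map_one, h6, h5]
  linear_combination  PowerSeries.C (1 / 2 : ℝ) * PowerSeries.C (1 / 2 : ℝ) * (sq - 1) * h3

theorem S_succ_succ (j : ℕ) : S (j + 2) = 2 * (G 0 * G (j + 2)) +
    ∑ p ∈ Finset.HasAntidiagonal.antidiagonal j, G (p.1 + 1) * G (p.2 + 1) := by
  unfold S
  rw [Finset.Nat.sum_antidiagonal_succ, Finset.Nat.sum_antidiagonal_succ']
  ring

theorem S_one : S 1 = 2 * (G 0 * G 1) := by
  unfold S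
  rw [Finset.Nat.sum_antidiagonal_succ]
  simp; ring

theorem sq_mul_G (k : ℕ) : sq * G (k + 1) = (S (k + 1) - 2 * (G 0 * G (k + 1))) +
    ∑ q ∈ Finset.HasAntidiagonal.antidiagonal k,
      (1 / ((q.1 + 1).factorial : ℝ)) • th^[q.1 + 1] (S q.2) := by
  have h := G_rec (k + 1)
  rw [Finset.Nat.sum_antidiagonal_succ] at h
  simp only [Nat.add_eq_zero_iff, one_ne_zero, and_false, if_false, zero_add, Nat.factorial_zero,
    Nat.cast_one, div_one, one_smul, Function.iterate_zero, id] at h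
  rw [sq_eq]
  linear_combination h

theorem Lau_S {a : ℕ → ℝ} {e : ℕ} (h : ∀ i ≤ e, Lau (3 * i + 2) (a (i + 1)) (G (i + 1))) :
    Lau (3 * e + 2) (a (e + 1)) (S (e + 1)) := by
  have h1 : Lau (3 * e + 2) (a (e + 1)) (2 * (G 0 * G (e + 1))) := by
    have := (Lau_G_zero.mul (h e le_rfl)).smul 2
    convert this using 1
    · ring
    · ring
    · rw [smul_eq_C_mul]; rfl
  rcases e with _ | e
  · rw [S_one]; exact h1
  · rw [S_succ_succ]
    have h2 := Lau.sum (Finset.HasAntidiagonal.antidiagonal e) (m := 3 * (e + 1) + 2) (a := fun _ => 0)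
      (f := fun p => G (p.1 + 1) * G (p.2 + 1)) (by
        intro p hp
        rw [Finset.HasAntidiagonal.mem_antidiagonal] at hp
        exact ((h p.1 (by omega)).mul (h p.2 (by omega))).lift (by omega))
    have h3 := h1.add h2
    simpa using h3

theorem Lau_G (a : ℕ → ℝ) (K : ℕ) (h1 : a 1 = 1 / 4)
    (h2 : ∀ j, j + 1 < K → a (j + 2) = (3 * j + 2) / 2 * a (j + 1) +
      ∑ p ∈ Finset.HasAntidiagonal.antidiagonal j, a (p.1 + 1) * a (p.2 + 1)) :
    ∀ k < K, Lau (3 * k + 2) (a (k + 1)) (G (k + 1)) := by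
  intro k
  induction k using Nat.strong_induction_on with
  | _ k ih =>
  intro hk
  have ih' : ∀ i < k, Lau (3 * i + 2) (a (i + 1)) (G (i + 1)) := fun i hi => ih i hi (hi.trans hk)
  apply Lau.div
  rw [sq_mul_G]
  rcases k with _ | j
  · rw [S_one, h1]
    simpa using Lau_thS
  · rw [S_succ_succ, Finset.Nat.sum_antidiagonal_succ, h2 j hk]
    have A := Lau.sum (Finset.HasAntidiagonal.antidiagonal j) (m := 3 * j + 4)
      (a := fun p => a (p.1 + 1) * a (p.2 + 1))
      (f := fun p => G (p.1 + 1) * G (p.2 + 1)) (by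
        intro p hp
        rw [Finset.HasAntidiagonal.mem_antidiagonal] at hp
        have := ((ih' p.1 (by omega)).mul (ih' p.2 (by omega)))
        rwa [show 3 * p.1 + 2 + (3 * p.2 + 2) = 3 * j + 4 by omega] at this)
    have B := (Lau_S (a := a) (e := j) fun i hi => ih' i (by omega)).th
    have C := Lau.sum (Finset.HasAntidiagonal.antidiagonal j) (m := 3 * j + 4) (a := fun _ => 0)
      (f := fun q => (1 / ((q.1 + 1 + 1).factorial : ℝ)) • th^[q.1 + 1 + 1] (S q.2)) (by
        rintro ⟨c, d⟩ hp
        rw [Finset.HasAntidiagonal.mem_antidiagonal] at hp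
        simp only at hp ⊢
        have : ∃ b m, m < 3 * j + 4 ∧ Lau m b (th^[c + 1 + 1] (S d)) := by
          rcases d with _ | e
          · obtain ⟨b, hb⟩ := Lau_thS.th_iter (c + 1)
            exact ⟨b, 1 + 2 * (c + 1), by omega, by rw [Function.iterate_succ_apply]; exact hb⟩
          · obtain ⟨b, hb⟩ := (Lau_S (a := a) (e := e) fun i hi => ih' i (by omega)).th_iter (c + 2)
            exact ⟨b, _, by omega, hb⟩
        obtain ⟨b, m, hm, hb⟩ := this
        have := (hb.lift hm).smul (1 / ((c + 1 + 1).factorial : ℝ))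
        rwa [mul_zero] at this)
    have D := A.add (B.add C)
    rw [Finset.sum_const_zero, add_zero] at D
    have e1 : (3 * (j : ℝ) + 2) / 2 * a (j + 1) +
        ∑ p ∈ Finset.HasAntidiagonal.antidiagonal j, a (p.1 + 1) * a (p.2 + 1) =
        ∑ p ∈ Finset.HasAntidiagonal.antidiagonal j, a (p.1 + 1) * a (p.2 + 1) +
          ((3 * j + 2 : ℕ) : ℝ) / 2 * a (j + 1) := by
      push_cast
      exact add_comm _ _
    rw [e1, add_sub_cancel_left, show 3 * (j + 1) + 1 = 3 * j + 4 by ring]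
    simpa using D

end TH

namespace TH

open PowerSeries Filter Topology BinaryTree

/-- The complete binary plane tree of a binary tree. -/
def toP : BinaryTree Unit → PTree
  | .nil => .node []
  | .node _ l r => .node [toP l, toP r]

theorem toP_inj : Function.Injective toP := by
  intro s
  induction s with
  | nil => intro t h; cases t with
    | nil => rfl
    | node _ l r => simp [toP] at h
  | node u l r ihl ihr => intro t h; cases t with
    | nil => simp [toP] at h
    | node u2 l2 r2 =>
      simp only [toP, PTree.node.injEq, List.cons.injEq, and_true] at h
      rw [ihl h.1, ihr h.2]

theorem toP_size (t : BinaryTree Unit) : (toP t).size = 2 * t.numNodes + 1 := by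
  induction t with
  | nil => simp [toP, PTree.size, numNodes]
  | node u l r ihl ihr =>
    rw [toP, PTree.size]
    simp [ihl, ihr, numNodes]; ring

theorem toP_height (t : BinaryTree Unit) :
    (toP t).totalHeight + 2 * t.numNodes = 2 * epl t := by
  induction t with
  | nil => simp [toP, PTree.totalHeight, numNodes, epl]
  | node u l r ihl ihr =>
    rw [toP, PTree.totalHeight]
    simp [toP_size, numNodes, epl, numLeaves_eq_numNodes_succ]
    omega

theorem toP_valid (t : BinaryTree Unit) : (toP t).validDeg {2} := by
  induction t with
  | nil => rw [toP, PTree.validDeg]; simp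
  | node u l r ihl ihr =>
    rw [toP, PTree.validDeg]
    simp [ihl, ihr]

theorem toP_surj (n : ℕ) : ∀ t : PTree, t.size ≤ n → t.validDeg {2} → ∃ b, toP b = t := by
  induction n with
  | zero =>
    intro t ht
    cases t with
    | node ts => rw [PTree.size] at ht; omega
  | succ n ih =>
    intro t ht hv
    cases t with
    | node ts =>
      rw [PTree.size] at ht
      rw [PTree.validDeg] at hv
      obtain ⟨h1, h2⟩ := hv
      rcases h1 with rfl | h1
      · exact ⟨.nil, rfl⟩
      · rw [Finset.mem_singleton, List.length_eq_two] at h1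
        obtain ⟨x, y, rfl⟩ := h1
        simp at ht
        obtain ⟨l, hl⟩ := ih x (by omega) (h2 x (by simp))
        obtain ⟨r, hr⟩ := ih y (by omega) (h2 y (by simp))
        exact ⟨.node () l r, by rw [toP, hl, hr]⟩

theorem T_eq (T : ℕ → Finset PTree)
    (hT : ∀ n : ℕ, ∀ t : PTree, t ∈ T n ↔ t.size = 2 * n + 1 ∧ t.validDeg {2}) (n : ℕ) :
    T n = (treesOfNumNodesEq n).map ⟨toP, toP_inj⟩ := by
  ext t
  rw [hT, Finset.mem_map]
  constructor
  · rintro ⟨h1, h2⟩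
    obtain ⟨b, rfl⟩ := toP_surj _ t le_rfl h2
    rw [toP_size] at h1
    exact ⟨b, by rw [mem_treesOfNumNodesEq]; omega, rfl⟩
  · rintro ⟨b, hb, rfl⟩
    rw [mem_treesOfNumNodesEq] at hb
    exact ⟨by simp [toP_size, hb], toP_valid b⟩

/-- Raw moments of the external path length. -/
noncomputable def mom (k n : ℕ) : ℝ :=
  (∑ t ∈ treesOfNumNodesEq n, (epl t : ℝ) ^ k) / ((treesOfNumNodesEq n).card : ℝ)

theorem card_pos (n : ℕ) : (0 : ℝ) < ((treesOfNumNodesEq n).card : ℝ) := by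
  have h : (treesOfNumNodesEq n).Nonempty := by
    rw [← Finset.card_pos, treesOfNumNodesEq_card_eq_catalan, catalan_eq_centralBinom_div]
    exact Nat.div_pos (Nat.le_of_dvd (Nat.centralBinom_pos n) (Nat.succ_dvd_centralBinom n))
      (Nat.succ_pos n)
  exact_mod_cast Finset.card_pos.2 h

theorem mom_zero (n : ℕ) : mom 0 n = 1 := by
  have := (card_pos n).ne'
  simp [mom, this]

theorem mom_eq (k n : ℕ) :
    mom k n = k.factorial * coeff (n + 1) (G k) / coeff (n + 1) (G 0) := by
  rw [G, G, coeff_succ_X_mul, coeff_succ_X_mul, Gp, Gp, coeff_mk, coeff_mk, mom, ← Finset.sum_div]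
  have : (k.factorial : ℝ) ≠ 0 := by positivity
  simp
  field_simp

theorem central (i n : ℕ) (μ D : ℝ) (hD : D ≠ 0) (T : Finset PTree)
    (hT : T = (treesOfNumNodesEq n).map ⟨toP, toP_inj⟩)
    (hμ : μ = (∑ t ∈ T, (t.totalHeight : ℝ)) / (T.card : ℝ)) :
    (∑ t ∈ T, ((t.totalHeight : ℝ) - μ) ^ i) / (T.card : ℝ) / (2 * D) ^ i =
      ∑ j ∈ Finset.range (i + 1), (mom j n / D ^ j) * (-(mom 1 n / D ^ 1)) ^ (i - j) * i.choose j := by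
  have hc := (card_pos n).ne'
  have hH : ∀ t ∈ treesOfNumNodesEq n, ((toP t).totalHeight : ℝ) = 2 * epl t - 2 * n := by
    intro t ht
    rw [mem_treesOfNumNodesEq] at ht
    have := toP_height t
    rw [ht] at this
    have h2 : ((toP t).totalHeight : ℝ) + 2 * n = 2 * epl t := by exact_mod_cast this
    linarith
  have hμ' : μ = 2 * mom 1 n - 2 * n := by
    rw [hμ, hT, Finset.sum_map, Finset.card_map]
    simp only [Function.Embedding.coeFn_mk]
    rw [Finset.sum_congr rfl hH, Finset.sum_sub_distrib, ← Finset.mul_sum, mom]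
    simp
    field_simp
  rw [hT, Finset.sum_map, Finset.card_map]
  simp only [Function.Embedding.coeFn_mk]
  have h1 : ∀ t ∈ treesOfNumNodesEq n, (((toP t).totalHeight : ℝ) - μ) ^ i =
      (2 * D) ^ i * ∑ j ∈ Finset.range (i + 1),
        ((epl t : ℝ) ^ j / D ^ j) * (-(mom 1 n / D ^ 1)) ^ (i - j) * i.choose j := by
    intro t ht
    rw [hH t ht, hμ']
    have : 2 * (epl t : ℝ) - 2 * n - (2 * mom 1 n - 2 * n) =
        (2 * D) * ((epl t : ℝ) / D + -(mom 1 n / D ^ 1)) := by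
      field_simp; ring
    rw [this, mul_pow, add_pow]
    simp only [div_pow]
  rw [Finset.sum_congr rfl h1, ← Finset.mul_sum, mul_div_assoc,
    mul_div_cancel_left₀ _ (pow_ne_zero _ (mul_ne_zero two_ne_zero hD)), Finset.sum_comm, Finset.sum_div]
  refine Finset.sum_congr rfl fun j _ => ?_
  rw [← Finset.sum_mul, ← Finset.sum_mul, ← Finset.sum_div]
  have e : mom j n = (∑ t ∈ treesOfNumNodesEq n, (epl t : ℝ) ^ j) /
    ((treesOfNumNodesEq n).card : ℝ) := rfl
  rw [e]
  ring

theorem G_zero_tendsto :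
    Tendsto (fun n : ℕ => coeff n (G 0) / (4 ^ n * (n : ℝ) ^ (-(3 / 2) : ℝ))) atTop
      (𝓝 (1 / (4 * Real.sqrt Real.pi))) := by
  have h := Bs_tendsto (-(1 / 2)) (by
    intro k hk
    have h2 : ((1 : ℕ) : ℝ) = ((2 * k : ℕ) : ℝ) := by push_cast; linarith
    have h3 : 1 = 2 * k := by exact_mod_cast h2
    omega)
  have h1 : Real.Gamma (-(1 / 2)) = -(2 * Real.sqrt Real.pi) := by
    have := Real.Gamma_add_one (s := -(1 / 2)) (by norm_num)
    rw [show (-(1 / 2) + 1 : ℝ) = 1 / 2 by norm_num, Real.Gamma_one_half_eq] at this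
    linarith
  rw [h1] at h
  have h2 := h.const_mul (-(1 / 2))
  have hp : Real.sqrt Real.pi ≠ 0 := by positivity
  have h3 : -(1 / 2) * (-(2 * Real.sqrt Real.pi))⁻¹ = 1 / (4 * Real.sqrt Real.pi) := by
    field_simp; norm_num
  rw [h3] at h2
  refine h2.congr' ?_
  filter_upwards [eventually_gt_atTop 0] with n hn
  rw [G_zero, show (-(1 / 2) - 1 : ℝ) = -(3 / 2) by norm_num, coeff_smul, map_sub, coeff_one, if_neg hn.ne', sq]
  simp; ring

theorem mom_tendsto (k : ℕ) (a : ℝ) (h : Lau (3 * k + 2) a (G (k + 1))) :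
    Tendsto (fun n : ℕ => mom (k + 1) n / (((n + 1 : ℕ) : ℝ) ^ (3 / 2 : ℝ)) ^ (k + 1)) atTop
      (𝓝 (4 * Real.sqrt Real.pi * (k + 1).factorial * a / Real.Gamma ((3 * k + 2) / 2))) := by
  have h1 := h.tendsto (by omega)
  have hp : Real.sqrt Real.pi ≠ 0 := by positivity
  have h2 := ((h1.const_mul ((k + 1).factorial : ℝ)).div G_zero_tendsto (by positivity)).comp
    (tendsto_add_atTop_nat 1)
  convert h2 using 1
  · ext n
    simp only [Function.comp_apply, Pi.div_apply]
    rw [mom_eq]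
    have hn : (0 : ℝ) < ((n + 1 : ℕ) : ℝ) := by positivity
    generalize ((n + 1 : ℕ) : ℝ) = N at hn
    have e : N ^ (((3 * k + 2 : ℕ) : ℝ) / 2 - 1) = (N ^ (3 / 2 : ℝ)) ^ (k + 1) * N ^ (-(3 / 2) : ℝ) := by
      rw [← Real.rpow_natCast (N ^ (3 / 2 : ℝ)), ← Real.rpow_mul hn.le, ← Real.rpow_add hn]
      congr 1; push_cast; ring
    rw [e]
    have h3 : N ^ (-(3 / 2) : ℝ) ≠ 0 := by positivity
    have h4 : (N ^ (3 / 2 : ℝ)) ≠ 0 := by positivity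
    have h5 : (4 : ℝ) ^ (n + 1) ≠ 0 := by positivity
    generalize N ^ (-(3 / 2) : ℝ) = u at *
    generalize (N ^ (3 / 2 : ℝ)) = v at *
    generalize (4 : ℝ) ^ (n + 1) = w at *
    rw [div_div_eq_mul_div]
    rcases eq_or_ne (coeff (n + 1) (G 0)) 0 with h6 | h6
    · simp [h6]
    · field_simp
  · congr 1
    push_cast
    field_simp

/-- The leading Laurent coefficients. -/
noncomputable def av (k : ℕ) : ℝ :=
  match k with
  | 1 => 1 / 4
  | 2 => 5 / 16
  | 3 => 15 / 16
  | 4 => 1105 / 256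
  | 5 => 1695 / 64
  | 6 => 414125 / 2048
  | 7 => 59025 / 32
  | 8 => 1282031525 / 65536
  | 9 => 242183775 / 1024
  | _ => 0

theorem Lau_av : ∀ k < 9, Lau (3 * k + 2) (av (k + 1)) (G (k + 1)) := by
  apply Lau_G
  · rfl
  · intro j hj
    have : j < 8 := by omega
    interval_cases j <;>
    simp only [Finset.Nat.antidiagonal_succ, Finset.Nat.antidiagonal_zero, Finset.sum_cons,
      Finset.sum_map, Finset.map_cons, Finset.map_singleton, Finset.sum_singleton, Function.Embedding.prodMap] <;> norm_num [av]

/-- Limits of normalized raw moments. -/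
noncomputable def cv (k : ℕ) : ℝ :=
  match k with
  | 0 => 1
  | 1 => Real.sqrt Real.pi
  | 2 => 10 / 3
  | 3 => 15 / 4 * Real.sqrt Real.pi
  | 4 => 884 / 63
  | 5 => 565 / 32 * Real.sqrt Real.pi
  | 6 => 662600 / 9009
  | 7 => 19675 / 192 * Real.sqrt Real.pi
  | 8 => 4102500880 / 8729721
  | 9 => 16145585 / 22528 * Real.sqrt Real.pi
  | _ => 0

theorem cv_tendsto (k : ℕ) (hk : k < 10) :
    Tendsto (fun n : ℕ => mom k n / (((n + 1 : ℕ) : ℝ) ^ (3 / 2 : ℝ)) ^ k) atTop (𝓝 (cv k)) := by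
  rcases k with _ | k
  · simp [mom_zero, cv]
  · have h := mom_tendsto k _ (Lau_av k (by omega))
    convert h using 2
    have hp : Real.sqrt Real.pi ≠ 0 := by positivity
    have hodd : ∀ q : ℕ, Real.Gamma ((3 * (2 * q : ℕ) + 2) / 2) = (3 * q).factorial := by
      intro q
      rw [← Real.Gamma_nat_eq_factorial]; congr 1; push_cast; ring
    have heven : ∀ q : ℕ, Real.Gamma ((3 * (2 * q + 1 : ℕ) + 2) / 2) =
        Real.Gamma ((3 * q + 2 : ℕ) + 1 / 2) := by
      intro q
      congr 1; push_cast; ring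
    have hk' : k < 9 := by omega
    interval_cases k
    · norm_num [av, cv]; ring
    · have := heven 0; rw [Real.Gamma_nat_add_half] at this
      norm_num [Nat.doubleFactorial] at this; norm_num [av, cv, this, Nat.factorial]; field_simp; norm_num
    · have := hodd 1; norm_num [Nat.factorial] at this; norm_num [av, cv, this, Nat.factorial]; field_simp; norm_num
    · have := heven 1; rw [Real.Gamma_nat_add_half] at this
      norm_num [Nat.doubleFactorial] at this; norm_num [av, cv, this, Nat.factorial]; field_simp; norm_num
    · have := hodd 2; norm_num [Nat.factorial] at this; norm_num [av, cv, this, Nat.factorial]; field_simp; norm_num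
    · have := heven 2; rw [Real.Gamma_nat_add_half] at this
      norm_num [Nat.doubleFactorial] at this; norm_num [av, cv, this, Nat.factorial]; field_simp; norm_num
    · have := hodd 3; norm_num [Nat.factorial] at this; norm_num [av, cv, this, Nat.factorial]; field_simp; norm_num
    · have := heven 3; rw [Real.Gamma_nat_add_half] at this
      norm_num [Nat.doubleFactorial] at this; norm_num [av, cv, this, Nat.factorial]; field_simp; norm_num
    · have := hodd 4; norm_num [Nat.factorial] at this; norm_num [av, cv, this, Nat.factorial]; field_simp; norm_num

/-- Limits of normalized central moments. -/
noncomputable def mv (i : ℕ) : ℝ :=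
  ∑ j ∈ Finset.range (i + 1), cv j * (-cv 1) ^ (i - j) * i.choose j

theorem mv_tendsto (i : ℕ) (hi : i < 10) :
    Tendsto (fun n : ℕ => ∑ j ∈ Finset.range (i + 1),
      (mom j n / (((n + 1 : ℕ) : ℝ) ^ (3 / 2 : ℝ)) ^ j) *
        (-(mom 1 n / (((n + 1 : ℕ) : ℝ) ^ (3 / 2 : ℝ)) ^ 1)) ^ (i - j) * i.choose j)
      atTop (𝓝 (mv i)) := by
  apply tendsto_finsetSum
  intro j hj
  have hj' : j < 10 := by rw [Finset.mem_range] at hj; omega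
  exact ((cv_tendsto j hj').mul ((cv_tendsto 1 (by norm_num)).neg.pow _)).mul_const _

theorem mv_two : mv 2 = (10 - 3 * Real.pi) / 3 := by
  have := Real.sq_sqrt Real.pi_pos.le
  simp [mv, Finset.sum_range_succ, cv]
  linear_combination (-1 : ℝ) * this

theorem mv_nine : mv 9 = (648 * Real.pi ^ 4 + 15795 * Real.pi ^ 3 + (591867 / 16) * Real.pi ^ 2
    - (461286225 / 2288) * Real.pi - 188411947088175 / 662165504) * Real.sqrt Real.pi / 81 := by
  have h := Real.sq_sqrt Real.pi_pos.le
  have hc : (Nat.choose 9 0 = 1 ∧ Nat.choose 9 1 = 9 ∧ Nat.choose 9 2 = 36 ∧ Nat.choose 9 3 = 84 ∧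
    Nat.choose 9 4 = 126 ∧ Nat.choose 9 5 = 126 ∧ Nat.choose 9 6 = 84 ∧ Nat.choose 9 7 = 36 ∧
    Nat.choose 9 8 = 9 ∧ Nat.choose 9 9 = 1) := by decide
  obtain ⟨h0, h1, h2, h3, h4, h5, h6, h7, h8, h9⟩ := hc
  simp only [mv, Finset.sum_range_succ, cv, Finset.sum_range_zero, h0, h1, h2, h3, h4, h5, h6, h7, h8, h9]
  generalize Real.sqrt Real.pi = s at *
  rw [← h]
  norm_num
  ring

theorem final (m9 m2 D : ℝ) (hD : 0 < D) (h2 : 0 ≤ m2) :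
    m9 / m2 ^ ((9 : ℕ) / 2 : ℝ) = (m9 / D ^ 9) / (m2 / D ^ 2) ^ ((9 : ℕ) / 2 : ℝ) := by
  rw [Real.div_rpow h2 (by positivity), ← Real.rpow_natCast D 2, ← Real.rpow_mul hD.le,
    ← Real.rpow_natCast D 9]
  have e : ((2 : ℕ) : ℝ) * ((9 : ℕ) / 2 : ℝ) = ((9 : ℕ) : ℝ) := by push_cast; norm_num
  rw [e]
  have : D ^ ((9 : ℕ) : ℝ) ≠ 0 := by positivity
  rw [div_div_div_cancel_right₀ this]

theorem const_eq (A x : ℝ) (hx : 0 < x) (p : ℝ) (hp : 0 < p) :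
    A * Real.sqrt p / 81 / (x / 3) ^ ((9 : ℕ) / 2 : ℝ) =
      A * Real.sqrt 3 * Real.sqrt (p / x) / x ^ 4 := by
  have hy : 0 < x / 3 := by positivity
  have e : (x / 3) ^ ((9 : ℕ) / 2 : ℝ) = (x / 3) ^ 4 * (Real.sqrt x / Real.sqrt 3) := by
    rw [← Real.sqrt_div hx.le, Real.sqrt_eq_rpow, ← Real.rpow_natCast, ← Real.rpow_add hy]
    norm_num
  rw [e, Real.sqrt_div hp.le]
  have h1 : Real.sqrt x ≠ 0 := by positivity
  have h3 : Real.sqrt 3 ≠ 0 := by positivity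
  field_simp
  norm_num

end TH

open Filter Real

/-- Let `H_n` be the total height (sum over all vertices of the distance to the root) on
complete binary trees with `2n+1` vertices, under the uniform distribution; with mean
`μ n`, central moments `m i n`, and scaled moments `α i n = m i n / (m 2 n)^(i/2)`,
the `9`-th scaled moment converges as `n → ∞` to the stated constant. -/
theorem totalheight_stmt13 (T : ℕ → Finset PTree)
    (hT : ∀ n : ℕ, ∀ t : PTree, t ∈ T n ↔ t.size = 2 * n + 1 ∧ t.validDeg {2})
    (μ : ℕ → ℝ)
    (hμ : ∀ n : ℕ, μ n = (∑ t ∈ T n, (t.totalHeight : ℝ)) / ((T n).card : ℝ))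
    (m : ℕ → ℕ → ℝ)
    (hm : ∀ i n : ℕ, m i n =
      (∑ t ∈ T n, ((t.totalHeight : ℝ) - μ n) ^ i) / ((T n).card : ℝ))
    (α : ℕ → ℕ → ℝ)
    (hα : ∀ i n : ℕ, α i n = m i n / (m 2 n) ^ ((i : ℝ) / 2)) :
    Tendsto (fun n : ℕ => α 9 n) atTop
      (nhds ((648 * π ^ 4 + 15795 * π ^ 3 + (591867 / 16) * π ^ 2 - (461286225 / 2288) * π - 188411947088175 / 662165504) * Real.sqrt 3 * Real.sqrt (π / (10 - 3 * π)) / (10 - 3 * π) ^ 4)) := by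
  have hpi : 0 < 10 - 3 * π := by have := Real.pi_lt_d2; linarith
  have hTe := TH.T_eq T hT
  have hN : ∀ n : ℕ, (0 : ℝ) < ((n + 1 : ℕ) : ℝ) ^ (3 / 2 : ℝ) := fun n => by positivity
  have hmi : ∀ i < 10, Tendsto (fun n : ℕ =>
      m i n / (2 * ((n + 1 : ℕ) : ℝ) ^ (3 / 2 : ℝ)) ^ i) atTop (nhds (TH.mv i)) := by
    intro i hi
    refine (TH.mv_tendsto i hi).congr fun n => ?_
    rw [hm]
    exact (TH.central i n (μ n) _ (hN n).ne' (T n) (hTe n) (hμ n)).symm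
  have h9 := hmi 9 (by norm_num)
  have h2 := hmi 2 (by norm_num)
  rw [TH.mv_nine] at h9
  rw [TH.mv_two] at h2
  have h3 := h9.div (h2.rpow_const (p := ((9 : ℕ) : ℝ) / 2) (Or.inl (by positivity)))
    (by positivity)
  rw [TH.const_eq _ _ hpi _ Real.pi_pos] at h3
  refine h3.congr fun n => ?_
  rw [hα, TH.final (m 9 n) (m 2 n) _ (mul_pos two_pos (hN n))]
  · rfl
  · rw [hm]
    positivity
end
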